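/- Let h : [0,T]×ℝ → ℝ be a Carathéodory function satisfying condition (A₁ᴵᴵ) (there exists γ ∈ L¹([0,T],[0,+∞)) with h(t,u) ≤ γ(t) for a.e. t and all u ∈ ℝ) and the Villari condition at +∞ with δ = −1 (there exists d₀ > 0 such that ∫₀ᵀ h(t,u(t)) dt < 0 for every u ∈ C¹_T with u(t) ≥ d₀ for all t ∈ [0,T]). Suppose there exists α ∈ 𝔇 which is a strict lower solution of the equation (φ(u'))' + f(u)u' + h(t,u) = 0. Then this equation has at least one T-periodic solution ũ with ũ(t) > α(t) for all t ∈ [0,T]. -/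

import Mathlib

open MeasureTheory Set Filter

noncomputable section

/-- The Lebesgue measure restricted to the interval `[0,T]`. -/
def muT (T : ℝ) : Measure ℝ := volume.restrict (Icc 0 T)

/-- `u` is a `C¹` function on `[0,T]` with derivative `u'` there, satisfying the
`T`-periodic boundary conditions `u 0 = u T` and `u' 0 = u' T`. -/
def IsC1Periodic (T : ℝ) (u u' : ℝ → ℝ) : Prop :=
  (∀ t ∈ Icc (0:ℝ) T, HasDerivWithinAt u (u' t) (Icc (0:ℝ) T) t) ∧
    ContinuousOn u' (Icc (0:ℝ) T) ∧ u 0 = u T ∧ u' 0 = u' T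

/-- `φ ∘ u'` is absolutely continuous on `[0,T]`, being the indefinite integral of the
integrable function `w` (which is then its a.e. derivative). -/
def IsACPhiDeriv (T : ℝ) (φ : ℝ → ℝ) (u' w : ℝ → ℝ) : Prop :=
  IntegrableOn w (Icc (0:ℝ) T) ∧
    ∀ t ∈ Icc (0:ℝ) T, φ (u' t) = φ (u' 0) + ∫ τ in (0:ℝ)..t, w τ

/-- `h : [0,T] × ℝ → ℝ` is a Carathéodory function: measurable in `t`, continuous in `u`
for a.e. `t`, and locally `L¹`-dominated. -/
def Caratheodory (T : ℝ) (h : ℝ → ℝ → ℝ) : Prop :=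
  (∀ u : ℝ, Measurable fun t => h t u) ∧
    (∀ᵐ t ∂(muT T), Continuous fun u => h t u) ∧
    ∀ r : ℝ, 0 < r → ∃ γ : ℝ → ℝ, IntegrableOn γ (Icc (0:ℝ) T) ∧
      ∀ᵐ t ∂(muT T), ∀ u : ℝ, |u| ≤ r → |h t u| ≤ γ t

/-- `u` is a `T`-periodic solution of `(φ(u'))' + f(u)u' + h(t,u) = 0`. -/
def IsSolE (T : ℝ) (φ f : ℝ → ℝ) (h : ℝ → ℝ → ℝ) (u : ℝ → ℝ) : Prop :=
  ∃ u' w : ℝ → ℝ, IsC1Periodic T u u' ∧ IsACPhiDeriv T φ u' w ∧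
    ∀ᵐ t ∂(muT T), w t + f (u t) * u' t + h t (u t) = 0

/-- Condition `(A₀)`: local uniform control of `h(t,u) − h(t,u₀)` for a.e. `t`. -/
def CondA0 (T : ℝ) (h : ℝ → ℝ → ℝ) : Prop :=
  ∀ t₀ ∈ Icc (0:ℝ) T, ∀ u₀ : ℝ, ∀ ε : ℝ, 0 < ε → ∃ δ : ℝ, 0 < δ ∧
    ∀ᵐ t ∂(muT T), |t - t₀| < δ → ∀ u : ℝ, |u - u₀| < δ → |h t u - h t u₀| < ε

section Brouwer

open Metric Topology

/-- The integral over a compact set of `det (1 + t A(x))` is a polynomial function of `t`. -/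
theorem exists_polynomial_setIntegral_det_one_add_smul {X ι : Type*} [TopologicalSpace X]
    [T2Space X] [MeasurableSpace X] [BorelSpace X] [Fintype ι] [DecidableEq ι] (μ : Measure X)
    [IsFiniteMeasureOnCompacts μ] {K : Set X} (hK : IsCompact K) {A : X → Matrix ι ι ℝ}
    (hA : ContinuousOn A K) :
    ∃ p : Polynomial ℝ, ∀ t : ℝ, ∫ x in K, (1 + t • A x).det ∂μ = p.eval t := by
  let c : Equiv.Perm ι → Finset ι → X → ℝ := fun σ S x =>
    (Equiv.Perm.sign σ : ℝ) * ((∏ i ∈ S, A x (σ i) i) *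
      ∏ i ∈ Finset.univ \ S, (1 : Matrix ι ι ℝ) (σ i) i)
  have hentry : ∀ i j, ContinuousOn (fun x => A x i j) K := fun i j =>
    (continuous_id.matrix_elem i j).comp_continuousOn hA
  have hc : ∀ σ S, ContinuousOn (c σ S) K := fun σ S =>
    continuousOn_const.mul ((continuousOn_finsetProd _ fun i _ => hentry _ _).mul
      continuousOn_const)
  have hexp : ∀ (t : ℝ) (x : X), (1 + t • A x).det =
      ∑ σ : Equiv.Perm ι, ∑ S ∈ (Finset.univ : Finset ι).powerset, c σ S x * t ^ S.card := by
    intro t x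
    rw [Matrix.det_apply']
    refine Finset.sum_congr rfl fun σ _ => ?_
    have : ∀ i, (1 + t • A x) (σ i) i = t * A x (σ i) i + (1 : Matrix ι ι ℝ) (σ i) i := by
      intro i; simp [add_comm]
    simp_rw [this]
    rw [Finset.prod_add, Finset.mul_sum]
    refine Finset.sum_congr rfl fun S _ => ?_
    rw [Finset.prod_mul_distrib, Finset.prod_const]
    simp only [c]
    ring
  refine ⟨∑ σ : Equiv.Perm ι, ∑ S ∈ (Finset.univ : Finset ι).powerset,
    Polynomial.C (∫ x in K, c σ S x ∂μ) * Polynomial.X ^ S.card, fun t => ?_⟩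
  have hterm : ∀ σ S, IntegrableOn (fun x => c σ S x * t ^ S.card) K μ := fun σ S =>
    ((hc σ S).mul continuousOn_const).integrableOn_compact hK
  simp_rw [hexp]
  rw [integral_finsetSum _ fun σ _ => integrable_finsetSum _ fun S _ => hterm σ S]
  simp only [Polynomial.eval_finsetSum, Polynomial.eval_mul, Polynomial.eval_C,
    Polynomial.eval_pow, Polynomial.eval_X]
  refine Finset.sum_congr rfl fun σ _ => ?_
  rw [integral_finsetSum _ fun S _ => hterm σ S]
  exact Finset.sum_congr rfl fun S _ => integral_mul_const _ _

/-- A Lipschitz function on the closed unit ball vanishing on the unit sphere stays Lipschitz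
when extended by zero. -/
theorem LipschitzOnWith.indicator_closedBall {E F : Type*} [NormedAddCommGroup E]
    [NormedSpace ℝ E] [NormedAddCommGroup F] {g : E → F} {C : NNReal}
    (hg : LipschitzOnWith C g (closedBall 0 1)) (h0 : ∀ x, ‖x‖ = 1 → g x = 0) :
    LipschitzWith C ((closedBall (0 : E) 1).indicator g) := by
  have key : ∀ x y : E, ‖x‖ ≤ 1 → ¬ ‖y‖ ≤ 1 → dist (g x) 0 ≤ C * dist x y := by
    intro x y hx hy
    obtain ⟨s, hs, hsz⟩ : (1 : ℝ) ∈ (fun s : ℝ => ‖x + s • (y - x)‖) '' Icc 0 1 :=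
      intermediate_value_Icc zero_le_one (by fun_prop) ⟨by simpa, by simpa using (not_le.1 hy).le⟩
    have hsz : ‖x + s • (y - x)‖ = 1 := hsz
    have h := hg.dist_le_mul x (by simpa) (x + s • (y - x)) (by simp [hsz])
    rw [h0 _ hsz] at h
    refine h.trans (mul_le_mul_of_nonneg_left ?_ C.2)
    rw [dist_eq_norm, dist_eq_norm, sub_add_cancel_left, norm_neg, norm_smul, Real.norm_eq_abs,
      abs_of_nonneg hs.1, norm_sub_rev]
    exact mul_le_of_le_one_left (norm_nonneg _) hs.2
  refine LipschitzWith.of_dist_le_mul fun x y => ?_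
  by_cases hx : x ∈ closedBall (0 : E) 1 <;> by_cases hy : y ∈ closedBall (0 : E) 1
  · rw [indicator_of_mem hx, indicator_of_mem hy]
    exact hg.dist_le_mul x hx y hy
  · rw [indicator_of_mem hx, indicator_of_notMem hy]
    exact key x y (by simpa using hx) (by simpa using hy)
  · rw [indicator_of_notMem hx, indicator_of_mem hy, dist_comm, dist_comm x]
    exact key y x (by simpa using hy) (by simpa using hx)
  · rw [indicator_of_notMem hx, indicator_of_notMem hy, dist_self]
    positivity

/-- A small Lipschitz perturbation of the identity, trivial off a set `s`, is injective and maps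
`s` onto itself. -/
theorem injective_and_image_eq_of_lipschitzWith_lt_one {E : Type*} [NormedAddCommGroup E]
    [CompleteSpace E] {g : E → E} {c : NNReal} (hc : c < 1) (hg : LipschitzWith c g) {s : Set E}
    (h0 : ∀ x ∉ s, g x = 0) :
    Function.Injective (fun x => x + g x) ∧ (fun x => x + g x) '' s = s := by
  have hinj : Function.Injective (fun x => x + g x) := by
    intro x y hxy
    have hxy : x + g x = y + g y := hxy
    have h1 : dist x y = dist (g x) (g y) := by
      rw [dist_eq_norm, dist_eq_norm, ← norm_neg (g x - g y)]
      congr 1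
      rw [neg_sub, sub_eq_sub_iff_add_eq_add, hxy, add_comm]
    have h2 := hg.dist_le_mul x y
    have hc' : (c : ℝ) < 1 := hc
    by_contra hne
    have := dist_pos.2 hne
    nlinarith
  have hsurj : ∀ y, ∃ x, x + g x = y := by
    intro y
    have hcon : ContractingWith c (fun x => y - g x) := by
      refine ⟨hc, LipschitzWith.of_dist_le_mul fun a b => ?_⟩
      rw [dist_sub_left]
      exact hg.dist_le_mul a b
    refine ⟨ContractingWith.fixedPoint _ hcon, ?_⟩
    have h := hcon.fixedPoint_isFixedPt
    exact eq_sub_iff_add_eq.1 h.symm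
  refine ⟨hinj, Subset.antisymm ?_ ?_⟩
  · rintro _ ⟨x, hx, rfl⟩
    by_contra hy
    have h : (x + g x) + g (x + g x) = x + g x := by rw [h0 _ hy, add_zero]
    have h' : x + g x = x := hinj h
    exact hy (by change x + g x ∈ s; rwa [h'])
  · intro y hy
    obtain ⟨x, hx⟩ := hsurj y
    refine ⟨x, ?_, hx⟩
    by_contra hxs
    rw [h0 x hxs, add_zero] at hx
    exact hxs (hx ▸ hy)

variable {E : Type*} [NormedAddCommGroup E] [InnerProductSpace ℝ E] [FiniteDimensional ℝ E]

/-- There is no `C¹` retraction of the closed unit ball onto the unit sphere. -/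
theorem not_contDiffOn_retraction_sphere {f : E → E} {U : Set E} (hU : IsOpen U)
    (hBU : closedBall (0 : E) 1 ⊆ U) (hf : ContDiffOn ℝ 1 f U)
    (hnorm : ∀ x ∈ closedBall (0 : E) 1, ‖f x‖ = 1) (hid : ∀ x, ‖x‖ = 1 → f x = x) : False := by
  classical
  let _ : MeasurableSpace E := borel E
  have : BorelSpace E := ⟨rfl⟩
  set B : Set E := closedBall 0 1 with hB
  have hBc : IsCompact B := isCompact_closedBall 0 1
  let μ : Measure E := Measure.addHaar
  let A : E → E →L[ℝ] E := fun x => fderiv ℝ f x - ContinuousLinearMap.id ℝ E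
  have hdf : ∀ x ∈ B, HasFDerivAt f (fderiv ℝ f x) x := fun x hx =>
    ((hf.differentiableOn one_ne_zero).differentiableAt (hU.mem_nhds (hBU hx))).hasFDerivAt
  have hdg : ∀ x ∈ B, HasFDerivAt (fun y => f y - y) (A x) x := fun x hx =>
    (hdf x hx).sub (hasFDerivAt_id x)
  have hAcont : ContinuousOn A B :=
    ((hf.continuousOn_fderiv_of_isOpen hU le_rfl).mono hBU).sub continuousOn_const
  obtain ⟨C, hC⟩ : ∃ C : ℝ, ∀ x ∈ B, ‖A x‖ ≤ C := hBc.exists_bound_of_continuousOn hAcont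
  have hlip : LipschitzOnWith C.toNNReal (fun y => f y - y) B :=
    (convex_closedBall 0 1).lipschitzOnWith_of_nnnorm_hasFDerivWithin_le
      (fun x hx => (hdg x hx).hasFDerivWithinAt) fun x hx => by
        rw [← NNReal.coe_le_coe]
        exact (hC x hx).trans (Real.le_coe_toNNReal C)
  have hG := hlip.indicator_closedBall fun x hx => by rw [hid x hx, sub_self]
  -- the determinant of a small perturbation of the identity is positive
  obtain ⟨δ, hδ, hdet⟩ : ∃ δ > 0, ∀ L : E →L[ℝ] E, ‖L‖ < δ →
      0 < (ContinuousLinearMap.id ℝ E + L).det := by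
    have hcd : ContinuousAt (fun L : E →L[ℝ] E => (ContinuousLinearMap.id ℝ E + L).det) 0 :=
      (ContinuousLinearMap.continuous_det.comp (continuous_const.add continuous_id)).continuousAt
    have h1 : (0 : ℝ) < (ContinuousLinearMap.id ℝ E + 0).det := by
      simp [ContinuousLinearMap.det]
    obtain ⟨δ, hδ, h⟩ := Metric.eventually_nhds_iff.1 (hcd.eventually (lt_mem_nhds h1))
    exact ⟨δ, hδ, fun L hL => h (by simpa using hL)⟩
  let b := Module.finBasis ℝ E
  obtain ⟨p, hp⟩ := exists_polynomial_setIntegral_det_one_add_smul μ hBc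
    (A := fun x => LinearMap.toMatrix b b (A x : E →ₗ[ℝ] E)) (by
      have : Continuous fun L : E →L[ℝ] E => LinearMap.toMatrix b b (L : E →ₗ[ℝ] E) :=
        LinearMap.continuous_of_finiteDimensional
          ((LinearMap.toMatrix b b).toLinearMap ∘ₗ ContinuousLinearMap.coeLM ℝ)
      exact this.comp_continuousOn hAcont)
  have hp' : ∀ t : ℝ, ∫ x in B, (ContinuousLinearMap.id ℝ E + t • A x).det ∂μ = p.eval t := by
    intro t
    rw [← hp t]
    refine integral_congr_ae (Eventually.of_forall fun x => ?_)
    change LinearMap.det _ = _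
    rw [← LinearMap.det_toMatrix b]
    simp
  set V : ℝ := ∫ _ in B, (1 : ℝ) ∂μ with hV
  have hVpos : 0 < V := by
    rw [hV, setIntegral_const, smul_eq_mul, mul_one]
    exact ENNReal.toReal_pos (measure_closedBall_pos μ 0 one_pos).ne' hBc.measure_lt_top.ne
  have hsmall : ∀ t ∈ Ioo (0 : ℝ) (min δ 1 / (|C| + 1)), p.eval t = V := by
    intro t ht
    have hCp : 0 < |C| + 1 := by positivity
    have htC : t * (|C| + 1) < min δ 1 := (lt_div_iff₀ hCp).1 ht.2
    have htC1 : t * |C| < min δ 1 := by nlinarith [ht.1]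
    let c : NNReal := ⟨t, ht.1.le⟩ * C.toNNReal
    have hc1 : c < 1 := by
      rw [← NNReal.coe_lt_coe]
      change t * max C 0 < 1
      have : max C 0 ≤ |C| := max_le (le_abs_self C) (abs_nonneg C)
      nlinarith [ht.1, min_le_right δ 1]
    have hGt : LipschitzWith c (fun x => t • B.indicator (fun y => f y - y) x) := by
      refine LipschitzWith.of_dist_le_mul fun x y => ?_
      rw [dist_smul₀, Real.norm_eq_abs, abs_of_pos ht.1]
      calc t * dist _ _ ≤ t * (C.toNNReal * dist x y) :=
            mul_le_mul_of_nonneg_left (hG.dist_le_mul x y) ht.1.le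
        _ = c * dist x y := by
            change _ = (t * (C.toNNReal : ℝ)) * dist x y
            ring
    obtain ⟨hinj, himg⟩ := injective_and_image_eq_of_lipschitzWith_lt_one hc1 hGt (s := B)
      fun x hx => by rw [indicator_of_notMem hx, smul_zero]
    have heq : EqOn (fun x => x + t • B.indicator (fun y => f y - y) x)
        (fun x => x + t • (f x - x)) B := fun x hx => by
      simp only [indicator_of_mem hx]
    have hchange := integral_image_eq_integral_abs_det_fderiv_smul μ hBc.measurableSet
      (f := fun x => x + t • (f x - x)) (f' := fun x => ContinuousLinearMap.id ℝ E + t • A x)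
      (fun x hx => ((hasFDerivAt_id x).add ((hdg x hx).const_smul t)).hasFDerivWithinAt)
      (heq.injOn_iff.1 hinj.injOn) (fun _ => (1 : ℝ))
    rw [← heq.image_eq, himg] at hchange
    rw [← hp' t, hV, hchange]
    refine setIntegral_congr_fun hBc.measurableSet fun x hx => ?_
    rw [smul_eq_mul, mul_one, abs_of_pos]
    apply hdet
    rw [norm_smul, Real.norm_eq_abs, abs_of_pos ht.1]
    have := (hC x hx).trans (le_abs_self C)
    nlinarith [ht.1, min_le_left δ 1]
  have hpV : p = Polynomial.C V := by
    refine Polynomial.eq_of_infinite_eval_eq _ _ (Infinite.mono (s := Ioo 0 _)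
      (fun t ht => ?_) (Ioo_infinite (a := (0 : ℝ)) (b := min δ 1 / (|C| + 1)) (by positivity)))
    simpa using hsmall t ht
  have hone := hp' 1
  rw [hpV, Polynomial.eval_C] at hone
  -- the derivative of a sphere-valued map is singular
  have hball : ∀ x ∈ ball (0 : E) 1, (ContinuousLinearMap.id ℝ E + (1 : ℝ) • A x).det = 0 := by
    intro x hx
    have hxB : x ∈ B := ball_subset_closedBall hx
    have hA : ContinuousLinearMap.id ℝ E + (1 : ℝ) • A x = fderiv ℝ f x := by
      rw [one_smul]; exact add_sub_cancel _ _
    have hort : ∀ v, inner ℝ (f x) (fderiv ℝ f x v) = 0 := by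
      intro v
      have h1 := (hdf x hxB).norm_sq
      have h2 : (fun y => ‖f y‖ ^ 2) =ᶠ[𝓝 x] fun _ => (1 : ℝ) := by
        filter_upwards [isOpen_ball.mem_nhds hx] with y hy
        rw [hnorm y (ball_subset_closedBall hy), one_pow]
      have h3 := (h1.congr_of_eventuallyEq h2.symm).unique (hasFDerivAt_const (1 : ℝ) x)
      have h4 := congrArg (fun L : E →L[ℝ] ℝ => L v) h3
      simpa using h4
    rw [hA]
    by_contra hne
    have hunit : IsUnit (LinearMap.det (fderiv ℝ f x : E →ₗ[ℝ] E)) := isUnit_iff_ne_zero.2 hne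
    obtain ⟨v, hv⟩ := ((Module.End.isUnit_iff _).1
      ((LinearMap.isUnit_iff_isUnit_det _).2 hunit)).surjective (f x)
    have hv' : fderiv ℝ f x v = f x := hv
    have h5 := hort v
    rw [hv', real_inner_self_eq_norm_sq, hnorm x hxB] at h5
    norm_num at h5
  have hzero : ∫ x in B, (ContinuousLinearMap.id ℝ E + (1 : ℝ) • A x).det ∂μ = 0 := by
    have hE : Nontrivial E := by
      refine ⟨f 0, 0, fun h => ?_⟩
      have := hnorm 0 (mem_closedBall_self zero_le_one)
      rw [h, norm_zero] at this
      exact zero_ne_one this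
    refine integral_eq_zero_of_ae ?_
    have hsph : ∀ᵐ x ∂μ.restrict B, x ∉ sphere (0 : E) 1 :=
      ae_restrict_of_ae (measure_eq_zero_iff_ae_notMem.1 (Measure.addHaar_sphere μ 0 1))
    filter_upwards [hsph, ae_restrict_mem hBc.measurableSet] with x hx hxB
    refine hball x ?_
    rw [← closedBall_sdiff_sphere]
    exact ⟨hxB, hx⟩
  linarith

/-- **Brouwer's fixed point theorem** for the unit ball. -/
theorem exists_fixedPoint_of_norm_le_one {F : E → E} (hF : Continuous F) (hF1 : ∀ x, ‖F x‖ ≤ 1) :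
    ∃ x, F x = x := by
  by_contra! hne
  have hBc : IsCompact (closedBall (0 : E) 1) := isCompact_closedBall 0 1
  obtain ⟨z, -, hz⟩ := hBc.exists_isMinOn ⟨0, mem_closedBall_self zero_le_one⟩
    (f := fun x => ‖x - F x‖) (by fun_prop)
  obtain ⟨ε, hε, hεle⟩ : ∃ ε > 0, ∀ x ∈ closedBall (0 : E) 1, 2 * ε ≤ ‖x - F x‖ :=
    ⟨‖z - F z‖ / 2, half_pos (norm_pos_iff.2 (sub_ne_zero.2 (hne z).symm)), fun x hx => by
      have : ‖z - F z‖ ≤ ‖x - F x‖ := hz hx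
      linarith⟩
  obtain ⟨g, hg, hgF, -⟩ := hF.exists_contDiff_approx 1 (ε := fun _ => ε) continuous_const
    fun _ => hε
  have hgn : ∀ x, ‖g x‖ < 1 + ε := by
    intro x
    have h1 := hgF x
    rw [dist_eq_norm] at h1
    have h2 := norm_le_norm_add_norm_sub' (g x) (F x)
    linarith [hF1 x]
  set G : E → E := fun x => (1 + ε)⁻¹ • g x with hGdef
  have hGs : ContDiff ℝ 1 G := contDiff_const.smul hg
  have hG1 : ∀ x, ‖G x‖ < 1 := by
    intro x
    rw [hGdef, norm_smul, Real.norm_eq_abs, abs_of_pos (by positivity), inv_mul_lt_iff₀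
      (by positivity), mul_one]
    exact hgn x
  have hGne : ∀ x ∈ closedBall (0 : E) 1, x - G x ≠ 0 := by
    intro x hx h0
    have hxG : g x = (1 + ε) • x := by
      rw [← smul_inv_smul₀ (show 1 + ε ≠ 0 by positivity) (g x)]
      exact congrArg _ (sub_eq_zero.1 h0).symm
    have h1 := hgF x
    have h2 : x - F x = (g x - F x) - ε • x := by rw [hxG, add_smul, one_smul]; abel
    have h3 := hεle x hx
    have h4 : ‖x‖ ≤ 1 := by simpa using hx
    have h5 := norm_sub_le (g x - F x) (ε • x)
    rw [norm_smul, Real.norm_eq_abs, abs_of_pos hε, ← h2] at h5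
    rw [dist_eq_norm] at h1
    nlinarith
  set d : E → E := fun x => x - G x with hd
  have hds : ContDiff ℝ 1 d := contDiff_id.sub hGs
  set q : E → ℝ := fun x => inner ℝ x (d x) with hq
  have hqs : ContDiff ℝ 1 q := contDiff_id.inner ℝ hds
  set D : E → ℝ := fun x => q x ^ 2 + ‖d x‖ ^ 2 * (1 - ‖x‖ ^ 2) with hD
  have hDs : ContDiff ℝ 1 D :=
    (hqs.pow 2).add ((hds.norm_sq ℝ).mul (contDiff_const.sub (contDiff_id.norm_sq ℝ)))
  have hqpos : ∀ x : E, ‖x‖ = 1 → 0 < q x := by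
    intro x hx
    have h1 : q x = 1 - inner ℝ x (G x) := by
      simp only [hq, hd, inner_sub_right, real_inner_self_eq_norm_sq, hx, one_pow]
    have h2 := real_inner_le_norm x (G x)
    rw [hx, one_mul] at h2
    linarith [hG1 x]
  have hDpos : ∀ x ∈ closedBall (0 : E) 1, 0 < D x := by
    intro x hx
    have hx1 : ‖x‖ ≤ 1 := by simpa using hx
    have hdp : 0 < ‖d x‖ := norm_pos_iff.2 (hGne x hx)
    rcases hx1.lt_or_eq with hlt | heq
    · have : 0 < 1 - ‖x‖ ^ 2 := by nlinarith [norm_nonneg x]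
      positivity
    · have := hqpos x heq
      have h0 : D x = q x ^ 2 := by simp only [hD, heq]; ring
      rw [h0]
      positivity
  set U : Set E := {x | d x ≠ 0} ∩ {x | 0 < D x}
  have hU : IsOpen U := (isOpen_ne_fun hds.continuous continuous_const).inter
    (isOpen_lt continuous_const hDs.continuous)
  set r : E → E := fun x => x + ((-q x + √(D x)) / ‖d x‖ ^ 2) • d x with hr
  have hrs : ContDiffOn ℝ 1 r U := by
    refine contDiffOn_id.add (ContDiffOn.smul (ContDiffOn.div (hqs.contDiffOn.neg.add
      (hDs.contDiffOn.sqrt fun x hx => hx.2.ne')) (hds.norm_sq ℝ).contDiffOn fun x hx => ?_)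
      hds.contDiffOn)
    exact pow_ne_zero 2 (norm_ne_zero_iff.2 hx.1)
  refine not_contDiffOn_retraction_sphere hU (fun x hx => ⟨hGne x hx, hDpos x hx⟩) hrs ?_ ?_
  · intro x hx
    have hdp : ‖d x‖ ^ 2 ≠ 0 := pow_ne_zero 2 (norm_ne_zero_iff.2 (hGne x hx))
    have hsq : ‖r x‖ ^ 2 = 1 := by
      set s := (-q x + √(D x)) / ‖d x‖ ^ 2 with hs
      have hs' : s * ‖d x‖ ^ 2 = -q x + √(D x) := div_mul_cancel₀ _ hdp
      have h1 : ‖r x‖ ^ 2 = ‖x‖ ^ 2 + 2 * (s * q x) + s ^ 2 * ‖d x‖ ^ 2 := by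
        simp only [hr, ← hs]
        rw [norm_add_sq_real, inner_smul_right, norm_smul, mul_pow, Real.norm_eq_abs, sq_abs]
      have h2 : √(D x) ^ 2 = q x ^ 2 + ‖d x‖ ^ 2 * (1 - ‖x‖ ^ 2) := Real.sq_sqrt (hDpos x hx).le
      have h3 : √(D x) = s * ‖d x‖ ^ 2 + q x := by linarith
      rw [h3] at h2
      rw [h1]
      apply mul_left_cancel₀ hdp
      linear_combination h2
    nlinarith [norm_nonneg (r x)]
  · intro x hx
    have h1 : √(D x) = q x := by
      have : D x = q x ^ 2 := by simp only [hD, hx]; ring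
      rw [this, Real.sqrt_sq (hqpos x hx).le]
    simp [hr, h1]

/-- **Brouwer's fixed point theorem**: a bounded continuous self-map of a finite-dimensional
inner product space has a fixed point. -/
theorem exists_fixedPoint_of_continuous_of_norm_le {F : E → E} (hF : Continuous F) {R : ℝ}
    (hR : ∀ x, ‖F x‖ ≤ R) : ∃ x, F x = x := by
  set ρ := max R 1
  have hρ : 0 < ρ := lt_max_of_lt_right one_pos
  obtain ⟨x, hx⟩ := exists_fixedPoint_of_norm_le_one (F := fun x => ρ⁻¹ • F (ρ • x))
    (by fun_prop) fun x => by
      rw [norm_smul, Real.norm_eq_abs, abs_of_pos (inv_pos.2 hρ), inv_mul_le_iff₀ hρ, mul_one]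
      exact (hR _).trans (le_max_left _ _)
  exact ⟨ρ • x, (inv_smul_eq_iff₀ hρ.ne').1 hx⟩

end Brouwer

/-- **Schauder's fixed point theorem** on a compact convex subset of a normed space. -/
theorem IsCompact.exists_fixedPoint_of_convex {X : Type*} [NormedAddCommGroup X]
    [NormedSpace ℝ X] {K : Set X} (hK : IsCompact K) (hKc : Convex ℝ K) (hKne : K.Nonempty)
    {f : X → X} (hf : ContinuousOn f K) (hm : MapsTo f K K) : ∃ x ∈ K, f x = x := by
  have happrox : ∀ ε > 0, ∃ x ∈ K, ‖f x - x‖ ≤ ε := by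
    intro ε hε
    obtain ⟨s, hsK, hsfin, hcov⟩ := hK.finite_cover_balls hε
    have : Fintype s := hsfin.fintype
    have hsne : Nonempty s := by
      obtain ⟨x, hx⟩ := hKne
      obtain ⟨i, hi, -⟩ := mem_iUnion₂.1 (hcov hx)
      exact ⟨⟨i, hi⟩⟩
    have hcard : (0 : ℝ) < Fintype.card s := by exact_mod_cast Fintype.card_pos
    let l : s → X → ℝ := fun i x => max 0 (ε - dist x i)
    have hl0 : ∀ i x, 0 ≤ l i x := fun i x => le_max_left _ _
    have hlc : ∀ i, Continuous (l i) := fun i => by simp only [l]; fun_prop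
    have hlpos : ∀ x ∈ K, 0 < ∑ i, l i x := by
      intro x hx
      obtain ⟨i, hi, hxi⟩ := mem_iUnion₂.1 (hcov hx)
      refine Finset.sum_pos' (fun i _ => hl0 i x) ⟨⟨i, hi⟩, Finset.mem_univ _, ?_⟩
      exact lt_max_of_lt_right (sub_pos.2 hxi)
    let S : EuclideanSpace ℝ s → ℝ := fun y => ∑ i, max (y i) 0
    have hSc : Continuous S := by simp only [S]; fun_prop
    let r : EuclideanSpace ℝ s → s → ℝ := fun y i =>
      (max (y i) 0 + max (1 - S y) 0 / Fintype.card s) / max 1 (S y)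
    have hmax : ∀ y, 0 < max 1 (S y) := fun y => lt_max_of_lt_left one_pos
    have hrc : ∀ i, Continuous fun y => r y i := by
      intro i
      refine Continuous.div (by fun_prop) (by fun_prop) fun y => (hmax y).ne'
    have hr0 : ∀ y i, 0 ≤ r y i := by
      intro y i
      have := hmax y
      have h1 := le_max_right (y i) 0
      have h2 := le_max_right (1 - S y) 0
      positivity
    have hr1 : ∀ y, ∑ i, r y i = 1 := by
      intro y
      simp only [r]
      rw [← Finset.sum_div, Finset.sum_add_distrib, Finset.sum_const, Finset.card_univ,
        nsmul_eq_mul, mul_div_cancel₀ _ hcard.ne', div_eq_one_iff_eq (hmax y).ne']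
      change S y + _ = _
      rcases le_total 1 (S y) with h | h
      · rw [max_eq_right (by linarith), max_eq_right h, add_zero]
      · rw [max_eq_left (by linarith), max_eq_left h]; ring
    let P : EuclideanSpace ℝ s → X := fun y => ∑ i, r y i • (i : X)
    have hPK : ∀ y, P y ∈ K := fun y =>
      hKc.sum_mem (fun i _ => hr0 y i) (hr1 y) fun i _ => hsK i.2
    have hPc : Continuous P := continuous_finsetSum _ fun i _ => (hrc i).smul continuous_const
    have hfP : Continuous fun y => f (P y) := hf.comp_continuous hPc hPK
    let G : EuclideanSpace ℝ s → EuclideanSpace ℝ s := fun y =>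
      WithLp.toLp 2 fun i => l i (f (P y)) / ∑ j, l j (f (P y))
    have hpos : ∀ y, 0 < ∑ j, l j (f (P y)) := fun y => hlpos _ (hm (hPK y))
    have hG0 : ∀ y i, 0 ≤ G y i := fun y i => div_nonneg (hl0 _ _) (hpos y).le
    have hG1 : ∀ y, ∑ i, G y i = 1 := by
      intro y
      change ∑ i, l i (f (P y)) / ∑ j, l j (f (P y)) = 1
      rw [← Finset.sum_div, div_self (hpos y).ne']
    have hGc : Continuous G := by
      refine (PiLp.continuous_toLp 2 _).comp (continuous_pi fun i => ?_)
      exact ((hlc i).comp hfP).div (continuous_finsetSum _ fun j _ => (hlc j).comp hfP)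
        fun y => (hpos y).ne'
    obtain ⟨y, hy⟩ := exists_fixedPoint_of_continuous_of_norm_le hGc (R := 1) fun y => by
      rw [EuclideanSpace.norm_eq]
      refine Real.sqrt_le_iff.2 ⟨zero_le_one, ?_⟩
      rw [one_pow, ← hG1 y]
      refine Finset.sum_le_sum fun i _ => ?_
      rw [Real.norm_eq_abs, sq_abs]
      have h1 : G y i ≤ 1 := by
        rw [← hG1 y]
        exact Finset.single_le_sum (fun j _ => hG0 y j) (Finset.mem_univ i)
      nlinarith [hG0 y i]
    have hy0 : ∀ i, 0 ≤ y i := fun i => hy ▸ hG0 y i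
    have hSy : S y = 1 := by
      have : ∑ i, y i = 1 := by rw [← hG1 y, hy]
      rw [← this]
      exact Finset.sum_congr rfl fun i _ => max_eq_left (hy0 i)
    have hry : ∀ i, r y i = y i := by
      intro i
      simp [r, hSy, hy0 i]
    refine ⟨P y, hPK y, ?_⟩
    have hy1 : ∑ i, y i = 1 := by rw [← hG1 y, hy]
    have hsub : f (P y) - P y = ∑ i, y i • (f (P y) - i) := by
      simp_rw [smul_sub]
      rw [Finset.sum_sub_distrib, ← Finset.sum_smul, hy1, one_smul]
      simp only [P, hry]
    rw [hsub]
    calc ‖∑ i, y i • (f (P y) - i)‖ ≤ ∑ i, y i * ε := by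
          refine norm_sum_le_of_le _ fun i _ => ?_
          rw [norm_smul, Real.norm_eq_abs, abs_of_nonneg (hy0 i)]
          by_cases hi : dist (f (P y)) i ≤ ε
          · rw [← dist_eq_norm]
            exact mul_le_mul_of_nonneg_left hi (hy0 i)
          · have : y i = 0 := by
              rw [← hy]
              change max 0 (ε - dist (f (P y)) i) / _ = 0
              rw [max_eq_left (by linarith), zero_div]
            rw [this, zero_mul, zero_mul]
      _ = ε := by rw [← Finset.sum_mul, hy1, one_mul]
  obtain ⟨x, hx, hmin⟩ := hK.exists_isMinOn hKne (f := fun x => ‖f x - x‖)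
    (hf.sub continuousOn_id).norm
  refine ⟨x, hx, sub_eq_zero.1 (norm_le_zero_iff.1 (le_of_forall_pos_le_add fun ε hε => ?_))⟩
  obtain ⟨y, hy, hyε⟩ := happrox ε hε
  rw [zero_add]
  exact (hmin hy).trans hyε

section PeriodicExistence

open Topology

/-- The set of `L`-Lipschitz functions on `[0,T]` with values at `t₀` in `[-A, A]` is compact. -/
theorem isCompact_setOf_lipschitzWith {T : ℝ} (t₀ : Icc (0 : ℝ) T) (A : ℝ) (L : NNReal) :
    IsCompact {u : C(Icc (0 : ℝ) T, ℝ) | |u t₀| ≤ A ∧ LipschitzWith L u} := by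
  refine ArzelaAscoli.isCompact_of_equicontinuous _ ?_ ?_
  · have himg : ContinuousMap.toFun '' {u : C(Icc (0 : ℝ) T, ℝ) | |u t₀| ≤ A ∧ LipschitzWith L u}
        = {u : Icc (0 : ℝ) T → ℝ | |u t₀| ≤ A ∧ LipschitzWith L u} := by
      ext u
      constructor
      · rintro ⟨v, hv, rfl⟩
        exact hv
      · intro hu
        exact ⟨⟨u, hu.2.continuous⟩, hu, rfl⟩
    rw [himg]
    refine (isCompact_univ_pi fun t : Icc (0 : ℝ) T =>
      isCompact_closedBall (0 : ℝ) (A + L * dist t t₀)).of_isClosed_subset ?_ ?_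
    · have hA : IsClosed {u : Icc (0 : ℝ) T → ℝ | |u t₀| ≤ A} :=
        isClosed_le (continuous_apply t₀).abs continuous_const
      refine hA.inter ?_
      have : {u : Icc (0 : ℝ) T → ℝ | LipschitzWith L u} =
          ⋂ s, ⋂ t, {u | dist (u s) (u t) ≤ L * dist s t} := by
        ext u
        simp only [mem_ofPred_eq, mem_iInter]
        exact ⟨fun h => h.dist_le_mul, LipschitzWith.of_dist_le_mul⟩
      change IsClosed {u : Icc (0 : ℝ) T → ℝ | LipschitzWith L u}
      rw [this]
      exact isClosed_iInter fun s => isClosed_iInter fun t =>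
        isClosed_le (by fun_prop) continuous_const
    · rintro u ⟨h1, h2⟩ t -
      have h3 := h2.dist_le_mul t t₀
      rw [mem_closedBall_zero_iff, Real.norm_eq_abs]
      rw [Real.dist_eq] at h3
      linarith [abs_sub_abs_le_abs_sub (u t) (u t₀)]
  · exact (LipschitzWith.uniformEquicontinuous _ L fun u => u.2.2).equicontinuous

/-- The continuous function `t ↦ ∫₀ᵗ e` on `[0,T]`. -/
def indefIntegral {T : ℝ} (e : ℝ → ℝ) (he : IntegrableOn e (Icc 0 T)) : C(Icc (0 : ℝ) T, ℝ) where
  toFun t := ∫ s in (0 : ℝ)..t, e s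
  continuous_toFun := by
    have h : ContinuousOn (fun t => ∫ s in (0 : ℝ)..t, e s) (Icc 0 T) :=
      (intervalIntegral.continuousOn_primitive he).congr fun t ht =>
        intervalIntegral.integral_of_le ht.1
    exact continuousOn_iff_continuous_domRestrict.1 h

theorem MeasureTheory.IntegrableOn.intervalIntegrable_of_mem_Icc {T : ℝ} {e : ℝ → ℝ}
    (he : IntegrableOn e (Icc 0 T)) {a b : ℝ} (ha : a ∈ Icc 0 T) (hb : b ∈ Icc 0 T) :
    IntervalIntegrable e volume a b :=
  (he.mono_set (uIcc_subset_Icc ha hb)).intervalIntegrable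

theorem abs_intervalIntegral_le_setIntegral_abs {T : ℝ} {e : ℝ → ℝ}
    (he : IntegrableOn e (Icc 0 T)) {t : ℝ} (ht : t ∈ Icc 0 T) :
    |∫ s in (0 : ℝ)..t, e s| ≤ ∫ s in Icc 0 T, |e s| := by
  refine (intervalIntegral.abs_integral_le_integral_abs ht.1).trans ?_
  rw [intervalIntegral.integral_of_le ht.1]
  exact setIntegral_mono_set he.abs (Eventually.of_forall fun s => abs_nonneg _)
    (Ioc_subset_Icc_self.trans (Icc_subset_Icc_right ht.2)).eventuallyLE

theorem dist_indefIntegral_le {T : ℝ} {e₁ e₂ : ℝ → ℝ} (h₁ : IntegrableOn e₁ (Icc 0 T))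
    (h₂ : IntegrableOn e₂ (Icc 0 T)) :
    dist (indefIntegral e₁ h₁) (indefIntegral e₂ h₂) ≤ ∫ s in Icc 0 T, |e₁ s - e₂ s| := by
  refine (ContinuousMap.dist_le (integral_nonneg fun s => abs_nonneg _)).2 fun t => ?_
  have h0 : (0 : ℝ) ∈ Icc 0 T := ⟨le_rfl, t.2.1.trans t.2.2⟩
  rw [Real.dist_eq]
  change |(∫ s in (0 : ℝ)..t, e₁ s) - ∫ s in (0 : ℝ)..t, e₂ s| ≤ _
  rw [← intervalIntegral.integral_sub (h₁.intervalIntegrable_of_mem_Icc h0 t.2)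
    (h₂.intervalIntegrable_of_mem_Icc h0 t.2)]
  exact abs_intervalIntegral_le_setIntegral_abs (h₁.sub h₂) t.2

/-- The primitive of a parameter-dependent integrand depends continuously, uniformly on `[0,T]`,
on the parameter. -/
theorem continuous_indefIntegral {X : Type*} [TopologicalSpace X] [FirstCountableTopology X]
    {T : ℝ} {e : X → ℝ → ℝ} (he : ∀ x, IntegrableOn (e x) (Icc 0 T)) {G : ℝ → ℝ}
    (hG : IntegrableOn G (Icc 0 T)) (hb : ∀ x, ∀ᵐ s ∂volume.restrict (Icc 0 T), |e x s| ≤ G s)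
    (hc : ∀ᵐ s ∂volume.restrict (Icc 0 T), Continuous fun x => e x s) :
    Continuous fun x => indefIntegral (e x) (he x) := by
  refine continuous_iff_continuousAt.2 fun x => tendsto_iff_dist_tendsto_zero.2 ?_
  refine squeeze_zero (fun _ => dist_nonneg) (fun y => dist_indefIntegral_le (he y) (he x)) ?_
  have h : Tendsto (fun y => ∫ s in Icc 0 T, |e y s - e x s|) (𝓝 x)
      (𝓝 (∫ s in Icc 0 T, (0 : ℝ))) := by
    refine tendsto_integral_filter_of_dominated_convergence (fun s => 2 * G s)
      (Eventually.of_forall fun y => ((he y).sub (he x)).abs.aestronglyMeasurable)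
      (Eventually.of_forall fun y => ?_) (hG.const_mul 2) ?_
    · filter_upwards [hb y, hb x] with s h1 h2
      rw [Real.norm_eq_abs, abs_abs]
      linarith [abs_sub (e y s) (e x s)]
    · filter_upwards [hc] with s hs
      have : Tendsto (fun y => |e y s - e x s|) (𝓝 x) (𝓝 |e x s - e x s|) :=
        ((hs.sub continuous_const).abs).continuousAt
      simpa using this
  simpa using h

theorem clamp_add_eq_self {C c x : ℝ} (hC : 0 ≤ C) (h : max (-C) (min C (c + x)) = c) :
    x = 0 ∨ (c = C ∧ 0 < x) ∨ (c = -C ∧ x < 0) := by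
  grind

/-- Periodic solvability of `φ(u') + F(u) = c - ∫₀ᵗ H(s,u(s)) ds` when `F` is bounded, `H` is
integrably bounded, and the mean of `H(·,u)` is negative for large `u` and positive for very
negative `u`. -/
theorem exists_periodic_of_bounded {T : ℝ} (hT : 0 < T) {φ F : ℝ → ℝ} (hφmono : StrictMono φ)
    (hφsurj : Function.Surjective φ) (hφ0 : φ 0 = 0) (hF : Continuous F) {B : ℝ}
    (hB : ∀ x, |F x| ≤ B) {H : ℝ → ℝ → ℝ} {G : ℝ → ℝ}
    (hHm : ∀ u : ℝ → ℝ, Continuous u →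
      AEStronglyMeasurable (fun t => H t (u t)) (volume.restrict (Icc 0 T)))
    (hHc : ∀ᵐ t ∂volume.restrict (Icc 0 T), Continuous (H t))
    (hG : IntegrableOn G (Icc 0 T))
    (hHG : ∀ᵐ t ∂volume.restrict (Icc 0 T), ∀ x, |H t x| ≤ G t) {A₀ : ℝ} (hA₀ : 0 ≤ A₀)
    (hneg : ∀ u : ℝ → ℝ, Continuous u → (∀ t ∈ Icc 0 T, A₀ ≤ u t) →
      ∫ t in Icc 0 T, H t (u t) < 0)
    (hpos : ∀ u : ℝ → ℝ, Continuous u → (∀ t ∈ Icc 0 T, u t ≤ -A₀) →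
      0 < ∫ t in Icc 0 T, H t (u t)) :
    ∃ (u u' : ℝ → ℝ) (c : ℝ), Continuous u ∧ IsC1Periodic T u u' ∧
      IntegrableOn (fun t => H t (u t)) (Icc 0 T) ∧ ∫ t in (0 : ℝ)..T, H t (u t) = 0 ∧
      ∀ t ∈ Icc 0 T, φ (u' t) + F (u t) = c - ∫ s in (0 : ℝ)..t, H s (u s) := by
  have h0T : (0 : ℝ) ∈ Icc 0 T := ⟨le_rfl, hT.le⟩
  have hTT : T ∈ Icc 0 T := ⟨hT.le, le_rfl⟩
  let e := hφmono.orderIsoOfSurjective φ hφsurj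
  let ψ : C(ℝ, ℝ) := ⟨e.symm, e.symm.continuous⟩
  have hφψ : ∀ x, φ (ψ x) = x := fun x => e.apply_symm_apply x
  have hψmono : Monotone ψ := e.symm.monotone
  have hψ0 : ψ 0 = 0 := (e.symm_apply_eq).2 hφ0.symm
  let Fc : C(ℝ, ℝ) := ⟨F, hF⟩
  have hext : ∀ u : C(Icc (0 : ℝ) T, ℝ), Continuous (IccExtend hT.le u) := fun u =>
    u.continuous.Icc_extend'
  have hHi : ∀ u : ℝ → ℝ, Continuous u → IntegrableOn (fun t => H t (u t)) (Icc 0 T) :=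
    fun u hu => hG.mono' (hHm u hu) (by filter_upwards [hHG] with t ht using ht _)
  have hci : ∀ u : ℝ → ℝ, Continuous u → IntegrableOn u (Icc 0 T) := fun u hu =>
    hu.continuousOn.integrableOn_compact isCompact_Icc
  let N : C(Icc (0 : ℝ) T, ℝ) → C(Icc (0 : ℝ) T, ℝ) := fun u =>
    indefIntegral (fun t => H t (IccExtend hT.le u t)) (hHi _ (hext u))
  have hNc : Continuous N := by
    refine continuous_indefIntegral (fun u => hHi _ (hext u)) hG (fun u => ?_) ?_
    · filter_upwards [hHG] with t ht using ht _
    · filter_upwards [hHc] with t ht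
      exact ht.comp (continuous_eval_const _)
  have hNb : ∀ u t, |N u t| ≤ ∫ s in Icc 0 T, G s := by
    intro u t
    refine (abs_intervalIntegral_le_setIntegral_abs (hHi _ (hext u)) t.2).trans ?_
    refine integral_mono_ae (hHi _ (hext u)).abs hG ?_
    filter_upwards [hHG] with t ht using ht _
  let J : C(Icc (0 : ℝ) T, ℝ) → C(Icc (0 : ℝ) T, ℝ) := fun q =>
    indefIntegral (IccExtend hT.le q) (hci _ (hext q))
  have hJc : Continuous J := by
    refine (LipschitzWith.of_dist_le_mul (K := ⟨T, hT.le⟩) fun q₁ q₂ => ?_).continuous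
    refine (dist_indefIntegral_le _ _).trans ?_
    have h1 : ∫ s in Icc 0 T, |IccExtend hT.le q₁ s - IccExtend hT.le q₂ s| ≤
        ∫ _ in Icc 0 T, dist q₁ q₂ := by
      refine integral_mono ((hci _ (hext q₁)).sub (hci _ (hext q₂))).abs (by simp) fun s => ?_
      exact (Real.dist_eq _ _).symm.le.trans
        (ContinuousMap.dist_apply_le_dist (projIcc 0 T hT.le s))
    refine h1.trans (le_of_eq ?_)
    rw [setIntegral_const, smul_eq_mul, measureReal_def, Real.volume_Icc, sub_zero,
      ENNReal.toReal_ofReal hT.le]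
    rfl
  have hB0 : 0 ≤ B := (abs_nonneg _).trans (hB 0)
  set Γ := ∫ s in Icc 0 T, G s with hΓ
  have hΓ0 : 0 ≤ Γ := (abs_nonneg _).trans (hNb 0 ⟨0, h0T⟩)
  set C := B + Γ with hCdef
  have hC0 : 0 ≤ C := by positivity
  let q : ℝ × C(Icc (0 : ℝ) T, ℝ) → C(Icc (0 : ℝ) T, ℝ) := fun p =>
    ψ.comp (ContinuousMap.const _ p.1 - Fc.comp p.2 - N p.2)
  have hqc : Continuous q := by
    refine (ContinuousMap.continuous_postcomp ψ).comp ?_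
    exact ((ContinuousMap.continuous_const'.comp continuous_fst).sub
      ((ContinuousMap.continuous_postcomp Fc).comp continuous_snd)).sub
      (hNc.comp continuous_snd)
  have hqa : ∀ p t, q p t = ψ (p.1 - F (p.2 t) - N p.2 t) := fun p t => rfl
  set L : ℝ := max |ψ (2 * C)| |ψ (-(2 * C))| with hL
  have hL0 : 0 ≤ L := le_max_of_le_left (abs_nonneg _)
  have hψL : ∀ x, |x| ≤ 2 * C → |ψ x| ≤ L := by
    intro x hx
    rw [hL, max_comm]
    exact abs_le_max_abs_abs (hψmono (abs_le.1 hx).1) (hψmono (abs_le.1 hx).2)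
  set A := A₀ + L * T with hA
  have hA00 : 0 ≤ A := by positivity
  let t₀ : Icc (0 : ℝ) T := ⟨0, h0T⟩
  let t₁ : Icc (0 : ℝ) T := ⟨T, hTT⟩
  let Φ : ℝ × C(Icc (0 : ℝ) T, ℝ) → ℝ × C(Icc (0 : ℝ) T, ℝ) := fun p =>
    (max (-C) (min C (p.1 + -J (q p) t₁)),
      ContinuousMap.const _ (max (-A) (min A (p.2 t₀ + N p.2 t₁))) + J (q p))
  have hΦc : Continuous Φ := by
    have h1 : Continuous fun p => J (q p) := hJc.comp hqc
    have h2 : Continuous fun p => J (q p) t₁ := (continuous_eval_const t₁).comp h1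
    have h3 : Continuous fun p : ℝ × C(Icc (0 : ℝ) T, ℝ) => N p.2 t₁ :=
      (continuous_eval_const t₁).comp (hNc.comp continuous_snd)
    have h4 : Continuous fun p : ℝ × C(Icc (0 : ℝ) T, ℝ) => p.2 t₀ :=
      (continuous_eval_const t₀).comp continuous_snd
    refine Continuous.prodMk (by fun_prop) (Continuous.add ?_ h1)
    exact ContinuousMap.continuous_const'.comp (by fun_prop)
  let K : Set (ℝ × C(Icc (0 : ℝ) T, ℝ)) :=
    Icc (-C) C ×ˢ {u : C(Icc (0 : ℝ) T, ℝ) | |u t₀| ≤ A ∧ LipschitzWith L.toNNReal u}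
  have hKcomp : IsCompact K := isCompact_Icc.prod (isCompact_setOf_lipschitzWith t₀ A _)
  have hKconv : Convex ℝ K := by
    refine (convex_Icc _ _).prod ?_
    rintro u ⟨hu0, hu⟩ v ⟨hv0, hv⟩ a b ha hb hab
    refine ⟨?_, LipschitzWith.of_dist_le_mul fun s t => ?_⟩
    · change |a * u t₀ + b * v t₀| ≤ A
      rw [abs_le] at *
      constructor <;> nlinarith
    · have h1 := hu.dist_le_mul s t
      have h2 := hv.dist_le_mul s t
      rw [Real.dist_eq] at *
      change |(a * u s + b * v s) - (a * u t + b * v t)| ≤ _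
      rw [abs_le] at *
      constructor <;> nlinarith
  have hKne : K.Nonempty := ⟨(0, 0), ⟨by linarith, hC0⟩, by simpa using hA00,
    LipschitzWith.of_dist_le_mul fun s t => by simp; positivity⟩
  have hqL : ∀ p ∈ K, ∀ t, |q p t| ≤ L := by
    intro p hp t
    refine hψL _ ?_
    have h1 := hNb p.2 t
    have h2 := hB (p.2 t)
    have h3 := abs_le.2 hp.1
    calc |p.1 - F (p.2 t) - N p.2 t| ≤ |p.1| + |F (p.2 t)| + |N p.2 t| :=
          (abs_sub _ _).trans (add_le_add_left (abs_sub _ _) _)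
      _ ≤ 2 * C := by linarith
  have hJ0 : ∀ r, J r t₀ = 0 := fun r => intervalIntegral.integral_same
  have hΦK : MapsTo Φ K K := by
    intro p hp
    refine ⟨⟨le_max_left _ _, max_le (by linarith) (min_le_left _ _)⟩, ?_, ?_⟩
    · change |max (-A) (min A (p.2 t₀ + N p.2 t₁)) + J (q p) t₀| ≤ A
      rw [hJ0, add_zero, abs_le]
      exact ⟨le_max_left _ _, max_le (by linarith) (min_le_left _ _)⟩
    · refine LipschitzWith.of_dist_le_mul fun s t => ?_
      change dist (_ + ∫ x in (0 : ℝ)..s, IccExtend hT.le (q p) x)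
        (_ + ∫ x in (0 : ℝ)..t, IccExtend hT.le (q p) x) ≤ _
      rw [ContinuousMap.const_apply, ContinuousMap.const_apply, dist_add_left, Real.dist_eq,
        intervalIntegral.integral_interval_sub_left
        ((hext _).intervalIntegrable _ _) ((hext _).intervalIntegrable _ _),
        Real.coe_toNNReal L hL0, Subtype.dist_eq, Real.dist_eq]
      exact intervalIntegral.norm_integral_le_of_norm_le_const
        (f := IccExtend hT.le (q p)) fun x _ => hqL p hp (projIcc 0 T hT.le x)
  obtain ⟨⟨c, u⟩, hp, hfix⟩ := hKcomp.exists_fixedPoint_of_convex hKconv hKne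
    hΦc.continuousOn hΦK
  set r := q (c, u) with hr
  have hfix1 : max (-C) (min C (c + -J r t₁)) = c := congrArg Prod.fst hfix
  have hfix2 : ContinuousMap.const _ (max (-A) (min A (u t₀ + N u t₁))) + J r = u :=
    congrArg Prod.snd hfix
  have hfixt : ∀ t, max (-A) (min A (u t₀ + N u t₁)) + J r t = u t := fun t =>
    congrArg (fun v : C(Icc (0 : ℝ) T, ℝ) => v t) hfix2
  have hfix0 : max (-A) (min A (u t₀ + N u t₁)) = u t₀ := by
    have := hfixt t₀
    rwa [hJ0, add_zero] at this
  have hut : ∀ t, u t = u t₀ + J r t := fun t => by rw [← hfixt t, hfix0]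
  have hJr : J r t₁ = 0 := by
    have hJi : J r t₁ = ∫ t in (0 : ℝ)..T, IccExtend hT.le r t := rfl
    have hb : ∀ t, |F (u t) + N u t| ≤ C := fun t =>
      (abs_add_le _ _).trans (add_le_add (hB _) (hNb u t))
    rcases clamp_add_eq_self hC0 hfix1 with h | ⟨h1, h2⟩ | ⟨h1, h2⟩
    · linarith
    · have : 0 ≤ J r t₁ := by
        rw [hJi]
        refine intervalIntegral.integral_nonneg_of_forall hT.le fun t => ?_
        change 0 ≤ q (c, u) _
        rw [hqa]
        refine hψ0.symm.le.trans (hψmono ?_)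
        have := (abs_le.1 (hb (projIcc 0 T hT.le t))).2
        simp only
        linarith
      linarith
    · have : 0 ≤ -J r t₁ := by
        rw [hJi, ← intervalIntegral.integral_neg]
        refine intervalIntegral.integral_nonneg_of_forall hT.le fun t => ?_
        change 0 ≤ -q (c, u) _
        rw [hqa, neg_nonneg]
        refine (hψmono ?_).trans hψ0.le
        have := (abs_le.1 (hb (projIcc 0 T hT.le t))).1
        simp only
        linarith
      linarith
  have hNT : N u t₁ = ∫ t in Icc 0 T, H t (IccExtend hT.le u t) := by
    rw [integral_Icc_eq_integral_Ioc, ← intervalIntegral.integral_of_le hT.le]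
    rfl
  have hosc : ∀ t, |u t - u t₀| ≤ L * T := by
    intro t
    have h := hp.2.2.dist_le_mul t t₀
    rw [Real.dist_eq, Real.coe_toNNReal L hL0, Subtype.dist_eq, Real.dist_eq] at h
    refine h.trans (mul_le_mul_of_nonneg_left ?_ hL0)
    change |(t : ℝ) - 0| ≤ T
    rw [sub_zero, abs_of_nonneg t.2.1]
    exact t.2.2
  have hNu : N u t₁ = 0 := by
    rcases clamp_add_eq_self hA00 hfix0 with h | ⟨h1, h2⟩ | ⟨h1, h2⟩
    · exact h
    · have := hneg _ (hext u) fun t _ => by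
        have := (abs_le.1 (hosc (projIcc 0 T hT.le t))).1
        change A₀ ≤ u _
        linarith
      linarith
    · have := hpos _ (hext u) fun t _ => by
        have := (abs_le.1 (hosc (projIcc 0 T hT.le t))).2
        change u _ ≤ -A₀
        linarith
      linarith
  have hdU : ∀ t, HasDerivAt (fun t => u t₀ + ∫ s in (0 : ℝ)..t, IccExtend hT.le r s)
      (IccExtend hT.le r t) t := fun t =>
    ((hext r).integral_hasStrictDerivAt 0 t).hasDerivAt.const_add _
  have hUeq : ∀ t ∈ Icc 0 T, u t₀ + ∫ s in (0 : ℝ)..t, IccExtend hT.le r s =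
      IccExtend hT.le u t := by
    intro t ht
    rw [IccExtend_of_mem _ _ ht, hut ⟨t, ht⟩]
    rfl
  have hr01 : r t₀ = r t₁ := by
    rw [hr, hqa, hqa]
    have h1 : u t₁ = u t₀ := by rw [hut t₁, hJr, add_zero]
    have h2 : N u t₀ = 0 := intervalIntegral.integral_same
    simp only [h1, h2, hNu]
  refine ⟨IccExtend hT.le u, IccExtend hT.le r, c, hext u, ⟨fun t ht => ?_,
    (hext r).continuousOn, ?_, ?_⟩, hHi _ (hext u), hNu, fun t ht => ?_⟩
  · exact (hdU t).hasDerivWithinAt.congr (fun s hs => (hUeq s hs).symm) (hUeq t ht).symm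
  · rw [← hUeq 0 h0T, ← hUeq T hTT, intervalIntegral.integral_same]
    exact congrArg (u t₀ + ·) hJr.symm
  · rw [IccExtend_of_mem _ _ h0T, IccExtend_of_mem _ _ hTT]
    exact hr01
  · rw [IccExtend_of_mem _ _ ht, IccExtend_of_mem _ _ ht, hr, hqa, hφψ]
    change c - F (u ⟨t, ht⟩) - (∫ s in (0 : ℝ)..t, H s (IccExtend hT.le u s)) + _ = _
    ring

end PeriodicExistence

section Comparison

open Topology

theorem HasDerivWithinAt.nonneg_of_forall_Ioc {x : ℝ → ℝ} {d a b : ℝ} (hab : a < b)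
    (hx : HasDerivWithinAt x d (Icc a b) a) (h : ∀ r ∈ Ioc a b, x a ≤ x r) : 0 ≤ d := by
  have hx' : HasDerivWithinAt x d (Ioc a b) a := hx.mono Ioc_subset_Icc_self
  rw [hasDerivWithinAt_iff_tendsto_slope' (by simp)] at hx'
  have : (𝓝[Ioc a b] a).NeBot := left_nhdsWithin_Ioc_neBot hab
  refine ge_of_tendsto hx' (eventually_mem_nhdsWithin.mono fun r hr => ?_)
  rw [slope_def_field]
  exact div_nonneg (sub_nonneg.2 (h r hr)) (sub_nonneg.2 hr.1.le)

theorem HasDerivWithinAt.comp_neg_Icc {x : ℝ → ℝ} {d a b r : ℝ}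
    (hx : HasDerivWithinAt x d (Icc a b) r) :
    HasDerivWithinAt (fun s => x (-s)) (-d) (Icc (-b) (-a)) (-r) := by
  have h := HasDerivWithinAt.scomp (t' := Icc a b) (h := fun s : ℝ => -s) (h' := -1) (-r)
    (by simpa using hx) (hasDerivAt_neg (-r)).hasDerivWithinAt
    (s := Icc (-b) (-a)) (fun s hs => ⟨by linarith [hs.2], by linarith [hs.1]⟩)
  simpa [Function.comp_def] using h

theorem HasDerivWithinAt.nonpos_of_forall_Ico {x : ℝ → ℝ} {d a b : ℝ} (hab : a < b)
    (hx : HasDerivWithinAt x d (Icc a b) b) (h : ∀ r ∈ Ico a b, x b ≤ x r) : d ≤ 0 := by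
  have h1 := hx.comp_neg_Icc.nonneg_of_forall_Ioc (neg_lt_neg hab) fun r hr => by
    simpa using h (-r) ⟨by linarith [hr.2], by linarith [hr.1]⟩
  linarith

/-- A function passing from a nonpositive to a positive value has a last zero, at which it does
not decrease. -/
theorem exists_last_zero {x x' : ℝ → ℝ} {p q : ℝ} (hpq : p ≤ q)
    (hx : ∀ t ∈ Icc p q, HasDerivWithinAt x (x' t) (Icc p q) t) (hp : x p ≤ 0) (hq : 0 < x q) :
    ∃ a ∈ Ico p q, x a = 0 ∧ 0 ≤ x' a ∧ ∀ r ∈ Ioc a q, 0 < x r := by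
  have hc : ContinuousOn x (Icc p q) := fun t ht => (hx t ht).continuousWithinAt
  have hcl : IsClosed (Icc p q ∩ x ⁻¹' Iic 0) := hc.preimage_isClosed_of_isClosed isClosed_Icc
    isClosed_Iic
  obtain ⟨a, ⟨ha, hxa⟩, hmax⟩ := (isCompact_Icc.of_isClosed_subset hcl
    inter_subset_left).exists_isGreatest ⟨p, ⟨le_rfl, hpq⟩, hp⟩
  have haq : a < q := lt_of_le_of_ne ha.2 fun h => by
    subst h
    exact absurd hxa (not_le.2 hq)
  have hpos : ∀ r ∈ Ioc a q, 0 < x r := fun r hr => by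
    by_contra! hr0
    exact absurd (hmax ⟨⟨ha.1.trans hr.1.le, hr.2⟩, hr0⟩) (not_le.2 hr.1)
  have hd : HasDerivWithinAt x (x' a) (Icc a q) a := (hx a ha).mono (Icc_subset_Icc_left ha.1)
  have : (𝓝[Ioc a q] a).NeBot := left_nhdsWithin_Ioc_neBot haq
  have hxa0 : x a = 0 := le_antisymm hxa <|
    ge_of_tendsto (hd.continuousWithinAt.mono Ioc_subset_Icc_self)
      (eventually_mem_nhdsWithin.mono fun r hr => (hpos r hr).le)
  exact ⟨a, ⟨ha.1, haq⟩, hxa0,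
    hd.nonneg_of_forall_Ioc haq fun r hr => hxa0.le.trans (hpos r hr).le, hpos⟩

theorem exists_first_zero {x x' : ℝ → ℝ} {p q : ℝ} (hpq : p ≤ q)
    (hx : ∀ t ∈ Icc p q, HasDerivWithinAt x (x' t) (Icc p q) t) (hp : 0 < x p) (hq : x q ≤ 0) :
    ∃ b ∈ Ioc p q, x b = 0 ∧ x' b ≤ 0 ∧ ∀ r ∈ Ico p b, 0 < x r := by
  obtain ⟨a, ha, h1, h2, h3⟩ := exists_last_zero (x := fun s => x (-s)) (x' := fun s => -x' (-s))
    (neg_le_neg hpq) (fun t ht => by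
      simpa using (hx (-t) ⟨by linarith [ht.2], by linarith [ht.1]⟩).comp_neg_Icc)
    (by simpa using hq) (by simpa using hp)
  refine ⟨-a, ⟨by linarith [ha.2], by linarith [ha.1]⟩, h1, by linarith, fun r hr => ?_⟩
  simpa using h3 (-r) ⟨by linarith [hr.2], by linarith [hr.1]⟩

theorem intervalIntegral_pos_of_ae_pos {e : ℝ → ℝ} {p q : ℝ} (hpq : p < q)
    (he : IntervalIntegrable e volume p q)
    (hpos : ∀ᵐ t ∂volume.restrict (Ioo p q), 0 < e t) : 0 < ∫ t in p..q, e t := by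
  rw [intervalIntegral.integral_of_le hpq.le, integral_Ioc_eq_integral_Ioo]
  have hi : Integrable e (volume.restrict (Ioo p q)) := he.1.mono_set Ioo_subset_Ioc_self
  refine (integral_pos_iff_support_of_nonneg_ae (hpos.mono fun t ht => ht.le) hi).2 ?_
  have : (Function.support e : Set ℝ) =ᵐ[volume.restrict (Ioo p q)] univ :=
    eventuallyEq_univ.2 (hpos.mono fun t ht => ht.ne')
  rw [measure_congr this]
  simpa using hpq

/-- Comparison of two periodic functions: if the difference of `φ(u') + F(u)` increases strictly
wherever `u₁ > u₂`, then `u₁ ≤ u₂`. -/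
theorem IsC1Periodic.le_of_strictMono {T : ℝ} (hT : 0 < T) {φ F : ℝ → ℝ} (hφ : Monotone φ)
    {u₁ u₁' u₂ u₂' e : ℝ → ℝ} {c : ℝ} (h₁ : IsC1Periodic T u₁ u₁') (h₂ : IsC1Periodic T u₂ u₂')
    (he : IntegrableOn e (Icc 0 T))
    (hD : ∀ t ∈ Icc 0 T, φ (u₁' t) + F (u₁ t) - (φ (u₂' t) + F (u₂ t)) =
      c + ∫ s in (0 : ℝ)..t, e s)
    (hpos : ∀ᵐ t ∂volume.restrict (Icc 0 T), u₂ t < u₁ t → 0 < e t) :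
    ∀ t ∈ Icc 0 T, u₁ t ≤ u₂ t := by
  have h0T : (0 : ℝ) ∈ Icc 0 T := ⟨le_rfl, hT.le⟩
  have hTT : T ∈ Icc 0 T := ⟨hT.le, le_rfl⟩
  set D : ℝ → ℝ := fun t => c + ∫ s in (0 : ℝ)..t, e s with hDdef
  have hlt : ∀ p ∈ Icc 0 T, ∀ q ∈ Icc 0 T, p < q → (∀ r ∈ Ioo p q, u₂ r < u₁ r) → D p < D q := by
    intro p hp q hq hpq h
    have h1 : 0 < ∫ s in p..q, e s := by
      refine intervalIntegral_pos_of_ae_pos hpq (he.intervalIntegrable_of_mem_Icc hp hq) ?_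
      filter_upwards [ae_restrict_of_ae_restrict_of_subset
        (Ioo_subset_Icc_self.trans (Icc_subset_Icc hp.1 hq.2)) hpos,
        ae_restrict_mem measurableSet_Ioo] with r hr1 hr2 using hr1 (h r hr2)
    have h2 := intervalIntegral.integral_add_adjacent_intervals
      (he.intervalIntegrable_of_mem_Icc h0T hp) (he.intervalIntegrable_of_mem_Icc hp hq)
    simp only [hDdef]
    linarith
  have hx : ∀ p ∈ Icc 0 T, ∀ q ∈ Icc 0 T, ∀ t ∈ Icc p q, HasDerivWithinAt
      (fun t => u₁ t - u₂ t) (u₁' t - u₂' t) (Icc p q) t := by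
    intro p hp q hq t ht
    have hs : Icc p q ⊆ Icc 0 T := Icc_subset_Icc hp.1 hq.2
    exact ((h₁.1 t (hs ht)).mono hs).sub ((h₂.1 t (hs ht)).mono hs)
  have hleft : ∀ s ∈ Icc 0 T, ∀ t ∈ Icc 0 T, s ≤ t → u₁ s ≤ u₂ s → u₂ t < u₁ t → 0 < D t := by
    intro s hs t ht hst h1 h2
    obtain ⟨a, ha, ha0, ha1, ha2⟩ := exists_last_zero hst (hx s hs t ht) (sub_nonpos.2 h1)
      (sub_pos.2 h2)
    have haT : a ∈ Icc 0 T := ⟨hs.1.trans ha.1, ha.2.le.trans ht.2⟩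
    have h3 := hlt a haT t ht ha.2 fun r hr => sub_pos.1 (ha2 r ⟨hr.1, hr.2.le⟩)
    have h4 := hφ (sub_nonneg.1 ha1)
    have h5 := hD a haT
    rw [sub_eq_zero.1 ha0] at h5
    simp only [hDdef] at h3 ⊢
    linarith
  have hright : ∀ s ∈ Icc 0 T, ∀ t ∈ Icc 0 T, t ≤ s → u₁ s ≤ u₂ s → u₂ t < u₁ t → D t < 0 := by
    intro s hs t ht hst h1 h2
    obtain ⟨b, hb, hb0, hb1, hb2⟩ := exists_first_zero hst (hx t ht s hs) (sub_pos.2 h2)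
      (sub_nonpos.2 h1)
    have hbT : b ∈ Icc 0 T := ⟨ht.1.trans hb.1.le, hb.2.trans hs.2⟩
    have h3 := hlt t ht b hbT hb.1 fun r hr => sub_pos.1 (hb2 r ⟨hr.1.le, hr.2⟩)
    have h4 := hφ (sub_nonpos.1 hb1)
    have h5 := hD b hbT
    rw [sub_eq_zero.1 hb0] at h5
    simp only [hDdef] at h3 ⊢
    linarith
  have hper : D 0 = D T := by
    rw [hDdef]
    simp only [← hD 0 h0T, ← hD T hTT, h₁.2.2.1, h₁.2.2.2, h₂.2.2.1, h₂.2.2.2]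
  intro t ht
  by_contra! hcon
  rcases le_or_gt (u₁ 0) (u₂ 0) with h0 | h0
  · have h1 := hleft 0 h0T t ht ht.1 h0 hcon
    have h2 := hright T hTT t ht ht.2 (by rwa [← h₁.2.2.1, ← h₂.2.2.1]) hcon
    linarith
  · by_cases hs : ∃ s ∈ Icc 0 T, u₁ s ≤ u₂ s
    · obtain ⟨s, hs, h1⟩ := hs
      have h2 := hleft s hs T hTT hs.2 h1 (by rwa [← h₁.2.2.1, ← h₂.2.2.1])
      have h3 := hright s hs 0 h0T hs.1 h1 h0
      linarith
    · push Not at hs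
      exact (hlt 0 h0T T hTT hT fun r hr => hs r ⟨hr.1.le, hr.2.le⟩).ne hper

/-- A periodic function takes each of its values at a point where its derivative is nonpositive. -/
theorem IsC1Periodic.exists_eq_deriv_nonpos {T : ℝ} (hT : 0 < T) {u u' : ℝ → ℝ}
    (hu : IsC1Periodic T u u') {t : ℝ} (ht : t ∈ Icc 0 T) :
    ∃ s ∈ Icc 0 T, u s = u t ∧ u' s ≤ 0 := by
  by_contra! hcon
  have hd : 0 < u' t := hcon t ht rfl
  have hx : ∀ p ∈ Icc 0 T, ∀ q ∈ Icc 0 T, ∀ r ∈ Icc p q, HasDerivWithinAt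
      (fun r => u r - u t) (u' r) (Icc p q) r := by
    intro p hp q hq r hr
    have hs : Icc p q ⊆ Icc 0 T := Icc_subset_Icc hp.1 hq.2
    exact ((hu.1 r (hs hr)).mono hs).sub_const _
  have h0T : (0 : ℝ) ∈ Icc 0 T := ⟨le_rfl, hT.le⟩
  have hTT : T ∈ Icc 0 T := ⟨hT.le, le_rfl⟩
  by_cases hc : t < T ∧ u T ≤ u t
  · obtain ⟨r, hr, hr1⟩ : ∃ r ∈ Ioc t T, 0 < u r - u t := by
      by_contra! h
      have := (hx t ht T hTT t ⟨le_rfl, ht.2⟩).neg.nonneg_of_forall_Ioc hc.1 fun r hr => by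
        simpa using h r hr
      linarith
    have hrT : r ∈ Icc 0 T := ⟨ht.1.trans hr.1.le, hr.2⟩
    obtain ⟨b, hb, hb0, hb1, -⟩ := exists_first_zero hr.2 (hx r hrT T hTT) hr1
      (sub_nonpos.2 hc.2)
    exact absurd hb1 (not_le.2 (hcon b ⟨hrT.1.trans hb.1.le, hb.2⟩ (sub_eq_zero.1 hb0)))
  · have h0 : u t ≤ u 0 := by
      rw [hu.2.2.1]
      rcases ht.2.lt_or_eq with h | h
      · exact (not_le.1 fun h' => hc ⟨h, h'⟩).le
      · rw [h]
    have ht0 : 0 < t := by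
      refine ht.1.lt_of_ne fun h => hc ⟨h ▸ hT, by rw [← hu.2.2.1, ← h]⟩
    obtain ⟨r, hr, hr1⟩ : ∃ r ∈ Ico 0 t, u r - u t < 0 := by
      by_contra! h
      have := (hx 0 h0T t ht t ⟨ht.1, le_rfl⟩).nonpos_of_forall_Ico ht0 fun r hr => by
        simpa using h r hr
      linarith
    have hrT : r ∈ Icc 0 T := ⟨hr.1, hr.2.le.trans ht.2⟩
    obtain ⟨a, ha, ha0, ha1, -⟩ := exists_last_zero (x := fun r => -(u r - u t))
      (x' := fun r => -u' r) hr.1 (fun s hs => (hx 0 h0T r hrT s hs).neg)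
      (by simpa using h0) (by simpa using hr1)
    refine absurd (hcon a ⟨ha.1, ha.2.le.trans hrT.2⟩ ?_) (by simpa using ha1)
    linarith

theorem IsC1Periodic.neg {T : ℝ} {u u' : ℝ → ℝ} (hu : IsC1Periodic T u u') :
    IsC1Periodic T (fun t => -u t) (fun t => -u' t) :=
  ⟨fun t ht => (hu.1 t ht).neg, hu.2.1.neg, congrArg Neg.neg hu.2.2.1, congrArg Neg.neg hu.2.2.2⟩

/-- One-sided control of a function with zero mean controls all its integrals. -/
theorem integral_sub_integral_le_of_le {T : ℝ} {g γ : ℝ → ℝ}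
    (hg : IntegrableOn g (Icc 0 T)) (hγ : IntegrableOn γ (Icc 0 T))
    (hgγ : ∀ᵐ t ∂volume.restrict (Icc 0 T), g t ≤ γ t)
    (hγ0 : ∀ᵐ t ∂volume.restrict (Icc 0 T), 0 ≤ γ t) (hg0 : ∫ t in (0 : ℝ)..T, g t = 0)
    {s t : ℝ} (hs : s ∈ Icc 0 T) (ht : t ∈ Icc 0 T) :
    (∫ x in (0 : ℝ)..t, g x) - ∫ x in (0 : ℝ)..s, g x ≤ ∫ x in Icc 0 T, γ x := by
  have hT : 0 ≤ T := hs.1.trans hs.2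
  have h0T : (0 : ℝ) ∈ Icc 0 T := ⟨le_rfl, hT⟩
  have hTT : T ∈ Icc 0 T := ⟨hT, le_rfl⟩
  have hle : ∀ p ∈ Icc 0 T, ∀ q ∈ Icc 0 T, p ≤ q → ∫ x in p..q, g x ≤ ∫ x in p..q, γ x := by
    intro p hp q hq hpq
    exact intervalIntegral.integral_mono_ae_restrict hpq (hg.intervalIntegrable_of_mem_Icc hp hq)
      (hγ.intervalIntegrable_of_mem_Icc hp hq)
      (ae_restrict_of_ae_restrict_of_subset (Icc_subset_Icc hp.1 hq.2) hgγ)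
  have hnn : ∀ p ∈ Icc 0 T, ∀ q ∈ Icc 0 T, p ≤ q → 0 ≤ ∫ x in p..q, γ x := by
    intro p hp q hq hpq
    exact intervalIntegral.integral_nonneg_of_ae_restrict hpq
      (ae_restrict_of_ae_restrict_of_subset (Icc_subset_Icc hp.1 hq.2) hγ0)
  have hadd : ∀ e : ℝ → ℝ, IntegrableOn e (Icc 0 T) → ∀ p ∈ Icc 0 T, ∀ q ∈ Icc 0 T,
      (∫ x in (0 : ℝ)..p, e x) + ∫ x in p..q, e x = ∫ x in (0 : ℝ)..q, e x :=
    fun e he p hp q hq => intervalIntegral.integral_add_adjacent_intervals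
      (he.intervalIntegrable_of_mem_Icc h0T hp) (he.intervalIntegrable_of_mem_Icc hp hq)
  have hΓ : ∫ x in Icc 0 T, γ x = ∫ x in (0 : ℝ)..T, γ x := by
    rw [integral_Icc_eq_integral_Ioc, ← intervalIntegral.integral_of_le hT]
  rw [hΓ]
  rcases le_total s t with hst | hst
  · linarith [hadd g hg s hs t ht, hadd γ hγ s hs t ht, hadd γ hγ t ht T hTT, hle s hs t ht hst,
      hnn 0 h0T s hs hs.1, hnn t ht T hTT ht.2]
  · linarith [hadd g hg s hs T hTT, hadd γ hγ t ht s hs, hadd γ hγ s hs T hTT, hle 0 h0T t ht ht.1,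
      hle s hs T hTT hs.2, hnn t ht s hs hst]

theorem IsC1Periodic.abs_phi_deriv_le {T : ℝ} (hT : 0 < T) {φ F : ℝ → ℝ} (hφ : Monotone φ)
    (hφ0 : φ 0 = 0) {u u' g γ : ℝ → ℝ} {c : ℝ} (hu : IsC1Periodic T u u')
    (hg : IntegrableOn g (Icc 0 T)) (hγ : IntegrableOn γ (Icc 0 T))
    (hgγ : ∀ᵐ t ∂volume.restrict (Icc 0 T), g t ≤ γ t)
    (hγ0 : ∀ᵐ t ∂volume.restrict (Icc 0 T), 0 ≤ γ t) (hg0 : ∫ t in (0 : ℝ)..T, g t = 0)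
    (heq : ∀ t ∈ Icc 0 T, φ (u' t) + F (u t) = c - ∫ s in (0 : ℝ)..t, g s)
    {t : ℝ} (ht : t ∈ Icc 0 T) : |φ (u' t)| ≤ ∫ x in Icc 0 T, γ x := by
  have h1 := heq t ht
  rw [abs_le]
  constructor
  · obtain ⟨s, hs, hs1, hs2⟩ := hu.neg.exists_eq_deriv_nonpos hT ht
    have h2 := heq s hs
    rw [neg_inj.1 hs1] at h2
    linarith [hφ (neg_nonpos.1 hs2), integral_sub_integral_le_of_le hg hγ hgγ hγ0 hg0 hs ht]
  · obtain ⟨s, hs, hs1, hs2⟩ := hu.exists_eq_deriv_nonpos hT ht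
    have h2 := heq s hs
    rw [hs1] at h2
    linarith [hφ hs2, integral_sub_integral_le_of_le hg hγ hgγ hγ0 hg0 ht hs]

theorem IsC1Periodic.abs_sub_le {T : ℝ} {u u' : ℝ → ℝ} (hu : IsC1Periodic T u u') {L : ℝ}
    (hL : ∀ t ∈ Icc 0 T, |u' t| ≤ L) {s t : ℝ} (hs : s ∈ Icc 0 T) (ht : t ∈ Icc 0 T) :
    |u t - u s| ≤ L * T := by
  refine ((convex_Icc 0 T).norm_image_sub_le_of_norm_hasDerivWithin_le hu.1 hL hs ht).trans ?_
  refine mul_le_mul_of_nonneg_left ?_ ((abs_nonneg _).trans (hL t ht))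
  rw [Real.norm_eq_abs, abs_le]
  exact ⟨by linarith [hs.2, ht.1], by linarith [ht.2, hs.1]⟩

theorem StrictMono.exists_abs_le_of_abs_le {φ : ℝ → ℝ} (hφ : StrictMono φ)
    (hφs : Function.Surjective φ) (Γ : ℝ) : ∃ L, ∀ y, |φ y| ≤ Γ → |y| ≤ L := by
  obtain ⟨a, ha⟩ := hφs (-Γ)
  obtain ⟨b, hb⟩ := hφs Γ
  refine ⟨max |a| |b|, fun y hy => abs_le_max_abs_abs ?_ ?_⟩
  · exact hφ.le_iff_le.1 (ha.le.trans (abs_le.1 hy).1)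
  · exact hφ.le_iff_le.1 ((abs_le.1 hy).2.trans hb.ge)

theorem IsC1Periodic.integral_comp_mul_deriv {T : ℝ} {f u u' : ℝ → ℝ} (hf : Continuous f)
    (hu : IsC1Periodic T u u') {t : ℝ} (ht : t ∈ Icc 0 T) :
    ∫ s in (0 : ℝ)..t, f (u s) * u' s = ∫ x in u 0..u t, f x := by
  have hs : uIcc 0 t ⊆ Icc 0 T := by
    rw [uIcc_of_le ht.1]
    exact Icc_subset_Icc_right ht.2
  refine intervalIntegral.integral_comp_mul_deriv''
    (fun s hs' => ((hu.1 s (hs hs')).mono hs).continuousWithinAt) (fun s hs' => ?_)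
    (hu.2.1.mono hs) hf.continuousOn
  rw [min_eq_left ht.1, max_eq_right ht.1] at hs'
  exact ((hu.1 s ⟨hs'.1.le, hs'.2.le.trans ht.2⟩).hasDerivAt
    (Icc_mem_nhds hs'.1 (hs'.2.trans_le ht.2))).hasDerivWithinAt

theorem Caratheodory.aestronglyMeasurable_comp {T : ℝ} {h : ℝ → ℝ → ℝ} (hh : Caratheodory T h)
    {w : ℝ → ℝ} (hw : Measurable w) :
    AEStronglyMeasurable (fun t => h t (w t)) (volume.restrict (Icc 0 T)) := by
  obtain ⟨s, hs, hsm, hs0⟩ := exists_measurable_superset_of_null (ae_iff.1 hh.2.1)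
  let g : ℝ → ℝ → ℝ := fun t x => sᶜ.indicator (fun t => h t x) t
  have hgc : ∀ t, Continuous (g t) := by
    intro t
    by_cases hts : t ∈ s
    · have : g t = fun _ => 0 := funext fun x => indicator_of_notMem (by simpa using hts) _
      rw [this]
      exact continuous_const
    · have : g t = h t := funext fun x => indicator_of_mem (by simpa using hts) _
      rw [this]
      by_contra hcon
      exact hts (hs hcon)
  have hgm : StronglyMeasurable (Function.uncurry fun x t => g t x) :=
    stronglyMeasurable_uncurry_of_continuous_of_stronglyMeasurable hgc fun x =>
      ((hh.1 x).indicator hsm.compl).stronglyMeasurable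
  refine ⟨fun t => g t (w t), hgm.comp_measurable (hw.prodMk measurable_id), ?_⟩
  have : ∀ᵐ t ∂volume.restrict (Icc 0 T), t ∉ s := measure_eq_zero_iff_ae_notMem.1 hs0
  filter_upwards [this] with t ht
  exact (indicator_of_mem (s := sᶜ) ht fun τ => h τ (w t)).symm

end Comparison

/-- Existence above a strict lower solution: if `h` is Carathéodory, bounded from above by
`γ` (condition `(A₁ᴵᴵ)`), satisfies the Villari condition at `+∞` with `δ = −1`, and `α ∈ 𝔇`
is a strict lower solution of `(φ(u'))' + f(u)u' + h(t,u) = 0`, then this equation has a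
`T`-periodic solution `ũ` with `ũ > α` on `[0,T]`. -/
theorem statement7
    (T : ℝ) (hT : 0 < T)
    (φ f : ℝ → ℝ)
    (hφmono : StrictMono φ) (hφcont : Continuous φ)
    (hφsurj : Function.Surjective φ) (hφ0 : φ 0 = 0)
    (hf : Continuous f)
    (h : ℝ → ℝ → ℝ) (hCar : Caratheodory T h)
    (γ : ℝ → ℝ) (hγint : IntegrableOn γ (Icc (0:ℝ) T))
    (hγpos : ∀ᵐ t ∂(muT T), 0 ≤ γ t)
    (hA1 : ∀ᵐ t ∂(muT T), ∀ u : ℝ, h t u ≤ γ t)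
    (hVillari : ∃ d₀ : ℝ, 0 < d₀ ∧ ∀ u u' : ℝ → ℝ, IsC1Periodic T u u' →
      (∀ t ∈ Icc (0:ℝ) T, d₀ ≤ u t) → (∫ t in Icc (0:ℝ) T, h t (u t)) < 0)
    (α α' wα : ℝ → ℝ)
    (hα : IsC1Periodic T α α') (hαAC : IsACPhiDeriv T φ α' wα)
    (hαineq : ∀ᵐ t ∂(muT T), 0 < wα t + f (α t) * α' t + h t (α t))
    (hαstrict : ∀ u : ℝ → ℝ, IsSolE T φ f h u → (∀ t ∈ Icc (0:ℝ) T, α t ≤ u t) →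
      ∀ t ∈ Icc (0:ℝ) T, α t < u t) :
    ∃ u : ℝ → ℝ, IsSolE T φ f h u ∧ ∀ t ∈ Icc (0:ℝ) T, α t < u t := by
  obtain ⟨d₀, hd₀, hV⟩ := hVillari
  unfold muT at hγpos hA1 hαineq
  have hTT : T ∈ Icc 0 T := ⟨hT.le, le_rfl⟩
  have hαc : ContinuousOn α (Icc 0 T) := fun t ht => (hα.1 t ht).continuousWithinAt
  obtain ⟨M, hM⟩ := isCompact_Icc.exists_bound_of_continuousOn hαc
  simp only [Real.norm_eq_abs] at hM
  obtain ⟨L, hL⟩ := hφmono.exists_abs_le_of_abs_le hφsurj (∫ t in Icc 0 T, γ t)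
  -- a continuous extension of `α`
  obtain ⟨a, hac, haα⟩ : ∃ a : ℝ → ℝ, Continuous a ∧ ∀ t ∈ Icc 0 T, a t = α t :=
    ⟨IccExtend hT.le ((Icc 0 T).domRestrict α), hαc.domRestrict.Icc_extend',
      fun t ht => IccExtend_of_mem _ _ ht⟩
  have haM : ∀ t ∈ Icc 0 T, |a t| ≤ M := fun t ht => (haα t ht).symm ▸ hM t ht
  have hM0 : 0 ≤ M := (abs_nonneg _).trans (hM T hTT)
  obtain ⟨R, hRM, hRd⟩ : ∃ R, M ≤ R ∧ d₀ + L * T ≤ R := ⟨_, le_max_left _ _, le_max_right _ _⟩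
  obtain ⟨G, hGi, hG⟩ := hCar.2.2 (R + 1) (by linarith)
  unfold muT at hG
  have hG0 : ∀ᵐ t ∂volume.restrict (Icc 0 T), 0 ≤ G t := by
    filter_upwards [hG] with t ht
    exact (abs_nonneg _).trans (ht 0 (by rw [abs_zero]; linarith))
  have hmem : ∀ᵐ t ∂volume.restrict (Icc 0 T), t ∈ Icc 0 T := ae_restrict_mem measurableSet_Icc
  have h1i : IntegrableOn (fun _ => (1 : ℝ)) (Icc 0 T) := by simp
  -- the truncated nonlinearities
  let S : ℝ → ℝ → ℝ := fun t x => max (-1) (min 1 (max (a t) (min x R) - x))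
  let H : ℝ → ℝ → ℝ := fun t x => h t (max (a t) (min x (R + 1))) + (G t + 1) * S t x
  let F : ℝ → ℝ := fun x => ∫ y in (0 : ℝ)..max (-(R + 1)) (min (R + 1) x), f y
  have hFc : Continuous F :=
    (intervalIntegral.continuous_primitive (fun _ _ => hf.intervalIntegrable _ _) 0).comp
      (by fun_prop)
  obtain ⟨B, hB⟩ : ∃ B, ∀ x, |F x| ≤ B := by
    obtain ⟨B, hB⟩ := (isCompact_Icc (a := -(R + 1)) (b := R + 1)).exists_bound_of_continuousOn
      (intervalIntegral.continuous_primitive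
        (fun _ _ => hf.intervalIntegrable (μ := volume) _ _) 0).continuousOn
    exact ⟨B, fun x => hB _ ⟨le_max_left _ _, max_le (by linarith) (min_le_left _ _)⟩⟩
  have hFu : ∀ v v' : ℝ → ℝ, IsC1Periodic T v v' → (∀ t ∈ Icc 0 T, |v t| ≤ R + 1) →
      ∀ t ∈ Icc 0 T, F (v t) = F (v 0) + ∫ s in (0 : ℝ)..t, f (v s) * v' s := by
    intro v v' hv hvR t ht
    have hcl : ∀ x, |x| ≤ R + 1 → F x = ∫ y in (0 : ℝ)..x, f y := fun x hx => by
      simp only [F]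
      rw [min_eq_right (abs_le.1 hx).2, max_eq_right (abs_le.1 hx).1]
    rw [hv.integral_comp_mul_deriv hf ht, hcl _ (hvR t ht), hcl _ (hvR 0 ⟨le_rfl, hT.le⟩),
      intervalIntegral.integral_add_adjacent_intervals (hf.intervalIntegrable _ _)
        (hf.intervalIntegrable _ _)]
  have hfu : ∀ v v' : ℝ → ℝ, IsC1Periodic T v v' →
      IntegrableOn (fun t => f (v t) * v' t) (Icc 0 T) := fun v v' hv =>
    ((hf.comp_continuousOn fun t ht => (hv.1 t ht).continuousWithinAt).mul
      hv.2.1).integrableOn_compact isCompact_Icc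
  have hS : ∀ t x, |S t x| ≤ 1 := fun t x =>
    abs_le.2 ⟨le_max_left _ _, max_le (by norm_num) (min_le_left _ _)⟩
  have hcl : ∀ t ∈ Icc 0 T, ∀ x, |max (a t) (min x (R + 1))| ≤ R + 1 := fun t ht x => by
    have := abs_le.1 (haM t ht)
    exact abs_le.2 ⟨le_max_of_le_left (by linarith), max_le (by linarith) (min_le_right _ _)⟩
  have hHm : ∀ u : ℝ → ℝ, Continuous u →
      AEStronglyMeasurable (fun t => H t (u t)) (volume.restrict (Icc 0 T)) := by
    intro u hu
    refine (hCar.aestronglyMeasurable_comp (Continuous.measurable (by fun_prop))).add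
      ((hGi.add h1i).aestronglyMeasurable.mul (Continuous.aestronglyMeasurable ?_))
    fun_prop
  have hHc : ∀ᵐ t ∂volume.restrict (Icc 0 T), Continuous (H t) := by
    filter_upwards [hCar.2.1] with t ht
    exact (ht.comp (by fun_prop)).add (by fun_prop)
  have hHG : ∀ᵐ t ∂volume.restrict (Icc 0 T), ∀ x, |H t x| ≤ G t + (G t + 1) := by
    filter_upwards [hG, hG0, hmem] with t h1 h2 h3 x
    refine (abs_add_le _ _).trans (add_le_add (h1 _ (hcl t h3 x)) ?_)
    rw [abs_mul, abs_of_nonneg (by linarith : 0 ≤ G t + 1)]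
    exact mul_le_of_le_one_right (by linarith) (hS t x)
  have hHi : ∀ u : ℝ → ℝ, Continuous u → IntegrableOn (fun t => H t (u t)) (Icc 0 T) :=
    fun u hu => (hGi.add (hGi.add h1i)).mono' (hHm u hu) (hHG.mono fun t ht => ht _)
  have hHhigh : ∀ᵐ t ∂volume.restrict (Icc 0 T), ∀ x, R + 1 ≤ x → H t x ≤ -1 := by
    filter_upwards [hG, hmem] with t h1 h2 x hx
    have h3 : S t x = -1 := by
      have := (abs_le.1 (haM t h2)).2
      simp only [S]
      grind
    have h4 := (abs_le.1 (h1 _ (hcl t h2 x))).2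
    simp only [H, h3]
    linarith
  have hHlow : ∀ᵐ t ∂volume.restrict (Icc 0 T), ∀ x, x < a t → h t (a t) < H t x := by
    filter_upwards [hG0, hmem] with t h1 h2 x hx
    have h3 : 0 < S t x := by
      have := (abs_le.1 (haM t h2)).2
      simp only [S]
      grind
    have h4 : max (a t) (min x (R + 1)) = a t := max_eq_left ((min_le_left _ _).trans hx.le)
    simp only [H, h4]
    linarith [mul_pos (by linarith : 0 < G t + 1) h3]
  have hHvlow : ∀ᵐ t ∂volume.restrict (Icc 0 T), ∀ x, x ≤ -(R + 2) → 1 ≤ H t x := by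
    filter_upwards [hG, hmem] with t h1 h2 x hx
    have h3 : S t x = 1 := by
      have := (abs_le.1 (haM t h2)).1
      simp only [S]
      grind
    have h4 := (abs_le.1 (h1 _ (hcl t h2 x))).1
    simp only [H, h3]
    linarith
  have hHmid : ∀ᵐ t ∂volume.restrict (Icc 0 T), ∀ x, a t ≤ x → x ≤ R + 1 → H t x ≤ h t x := by
    filter_upwards [hG0] with t h1 x hx1 hx2
    have h3 : S t x ≤ 0 := by
      simp only [S]
      grind
    simp only [H]
    rw [min_eq_left hx2, max_eq_right hx1]
    linarith [mul_nonpos_of_nonneg_of_nonpos (by linarith : 0 ≤ G t + 1) h3]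
  have hHeq : ∀ t x, a t ≤ x → x ≤ R → H t x = h t x := by
    intro t x hx1 hx2
    have h3 : S t x = 0 := by
      simp only [S]
      grind
    simp only [H, h3]
    rw [min_eq_left (by linarith), max_eq_right hx1, mul_zero, add_zero]
  have hconst : ∀ b : ℝ, ∫ _ in Icc 0 T, b = T * b := fun b => by
    rw [setIntegral_const, smul_eq_mul, measureReal_def, Real.volume_Icc, sub_zero,
      ENNReal.toReal_ofReal hT.le]
  obtain ⟨u, u', c, huc, hu, hgi, hg0, heq⟩ := exists_periodic_of_bounded hT hφmono hφsurj hφ0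
    hFc hB hHm hHc (hGi.add (hGi.add h1i)) hHG (A₀ := R + 2) (by linarith)
    (fun v hv hvA => by
      have h1 : ∫ t in Icc 0 T, H t (v t) ≤ ∫ _ in Icc 0 T, (-1 : ℝ) := by
        refine integral_mono_ae (hHi v hv) (by simp) ?_
        filter_upwards [hHhigh, hmem] with t h1 h2 using h1 _ (by linarith [hvA t h2])
      rw [hconst] at h1
      linarith)
    (fun v hv hvA => by
      have h1 : ∫ _ in Icc 0 T, (1 : ℝ) ≤ ∫ t in Icc 0 T, H t (v t) := by
        refine integral_mono_ae (by simp) (hHi v hv) ?_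
        filter_upwards [hHvlow, hmem] with t h1 h2 using h1 _ (hvA t h2)
      rw [hconst] at h1
      linarith)
  have hII : ∀ {e : ℝ → ℝ} {t : ℝ}, IntegrableOn e (Icc 0 T) → t ∈ Icc 0 T →
      IntervalIntegrable e volume 0 t := fun he ht =>
    he.intervalIntegrable_of_mem_Icc ⟨le_rfl, hT.le⟩ ht
  have hαu : ∀ t ∈ Icc 0 T, α t ≤ u t := by
    refine hα.le_of_strictMono hT hφmono.monotone hu (F := F) (c := φ (α' 0) + F (α 0) - c)
      (e := fun t => wα t + f (α t) * α' t + H t (u t))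
      ((hαAC.1.add (hfu α α' hα)).add hgi) (fun t ht => ?_) ?_
    · have h1 := hαAC.2 t ht
      have h2 := hFu α α' hα (fun t ht => (hM t ht).trans (by linarith)) t ht
      have h3 := heq t ht
      rw [intervalIntegral.integral_add ((hII hαAC.1 ht).add (hII (hfu α α' hα) ht)) (hII hgi ht),
        intervalIntegral.integral_add (hII hαAC.1 ht) (hII (hfu α α' hα) ht)]
      linarith
    · filter_upwards [hαineq, hHlow, hmem] with t h1 h2 h3 h4
      have h5 := h2 (u t) (by rwa [haα t h3])
      rw [haα t h3] at h5
      linarith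
  have huR : ∀ t ∈ Icc 0 T, u t ≤ R + 1 := by
    refine hu.le_of_strictMono hT hφmono.monotone (u₂ := fun _ => R + 1) (u₂' := fun _ => 0)
      ⟨fun t _ => hasDerivWithinAt_const _ _ _, continuousOn_const, rfl, rfl⟩ (F := F)
      (c := c - (φ 0 + F (R + 1))) (e := fun t => -H t (u t)) hgi.neg (fun t ht => ?_) ?_
    · rw [heq t ht, intervalIntegral.integral_neg]
      ring
    · filter_upwards [hHhigh] with t h1 h2
      linarith [h1 _ h2.le]
  have huabs : ∀ t ∈ Icc 0 T, |u t| ≤ R + 1 := fun t ht => abs_le.2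
    ⟨by linarith [(abs_le.1 (hM t ht)).1, hαu t ht], huR t ht⟩
  have hHh : ∀ᵐ t ∂volume.restrict (Icc 0 T), H t (u t) ≤ h t (u t) := by
    filter_upwards [hHmid, hmem] with t h1 h2
    exact h1 _ ((haα t h2).le.trans (hαu t h2)) (huR t h2)
  have hhi : IntegrableOn (fun t => h t (u t)) (Icc 0 T) := by
    refine hGi.mono' (hCar.aestronglyMeasurable_comp huc.measurable) ?_
    filter_upwards [hG, hmem] with t h1 h2 using h1 _ (huabs t h2)
  have hosc : ∀ s ∈ Icc 0 T, ∀ t ∈ Icc 0 T, |u t - u s| ≤ L * T := fun s hs t ht =>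
    hu.abs_sub_le (fun r hr => hL _ (hu.abs_phi_deriv_le hT hφmono.monotone hφ0 hgi hγint
      (by filter_upwards [hHh, hA1] with x h1 h2 using h1.trans (h2 _)) hγpos hg0 heq hr)) hs ht
  obtain ⟨s, hs, hsd⟩ : ∃ s ∈ Icc 0 T, u s < d₀ := by
    by_contra! hcon
    have h1 := hV u u' hu hcon
    have h2 := integral_mono_ae hgi hhi hHh
    rw [integral_Icc_eq_integral_Ioc, ← intervalIntegral.integral_of_le hT.le, hg0] at h2
    linarith
  have huR' : ∀ t ∈ Icc 0 T, u t ≤ R := fun t ht => by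
    linarith [(abs_le.1 (hosc s hs t ht)).2]
  have hHu : ∀ t ∈ Icc 0 T, H t (u t) = h t (u t) := fun t ht =>
    hHeq t _ ((haα t ht).le.trans (hαu t ht)) (huR' t ht)
  have hsol : IsSolE T φ f h u := by
    refine ⟨u', fun t => -(f (u t) * u' t) - h t (u t), hu, ⟨(hfu u u' hu).neg.sub hhi,
      fun t ht => ?_⟩, Eventually.of_forall fun t => by ring⟩
    have h1 := heq t ht
    have h2 := heq 0 ⟨le_rfl, hT.le⟩
    have h3 := hFu u u' hu huabs t ht
    have h4 : ∫ s in (0 : ℝ)..t, H s (u s) = ∫ s in (0 : ℝ)..t, h s (u s) := by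
      refine intervalIntegral.integral_congr fun s hs' => hHu s ?_
      rw [uIcc_of_le ht.1] at hs'
      exact ⟨hs'.1, hs'.2.trans ht.2⟩
    rw [intervalIntegral.integral_same] at h2
    have h5 : ∫ s in (0 : ℝ)..t, (-(f (u s) * u' s) - h s (u s)) =
        -(∫ s in (0 : ℝ)..t, f (u s) * u' s) - ∫ s in (0 : ℝ)..t, h s (u s) := by
      rw [← intervalIntegral.integral_neg]
      exact intervalIntegral.integral_sub (hII (hfu u u' hu) ht).neg (hII hhi ht)
    linarith
  exact ⟨u, hsol, hαstrict u hsol hαu⟩
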